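/- Let g₁,…,g_m ∈ ℝ[x₁,…,xₙ] and suppose K = {x ∈ ℝⁿ : g_j(x) ≥ 0 for j = 1,…,m} is compact. Suppose a real sequence z = (z_{αk}), (α,k) ∈ ℕⁿ × ℕ, satisfies L_z(h² · g^β) ≥ 0 for every β ∈ {0,1}^m and every h ∈ ℝ[x₁,…,xₙ,t]. Then L_z(f) ≥ 0 for every polynomial f ∈ ℝ[x₁,…,xₙ,t] that is nonnegative on K × ℝ. -/

import Mathlib

open MeasureTheory Polynomial

/-- The Riesz functional of a sequence `z = (z_{αk})`, acting on `ℝ[x₁,…,xₙ][t]`: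
`L_z(x^α t^k) = z_{αk}`, extended linearly. -/
noncomputable def riesz {n : ℕ} (z : (Fin n →₀ ℕ) × ℕ → ℝ)
    (f : Polynomial (MvPolynomial (Fin n) ℝ)) : ℝ :=
  f.sum fun k c => ∑ α ∈ c.support, MvPolynomial.coeff α c * z (α, k)

/-- In a commutative ring, every proper subsemiring containing all squares is contained in
an ordering (a prime cone). -/
theorem exists_primeCone {A : Type*} [CommRing A] (T : Subsemiring A)
    (hsq : ∀ a : A, a ^ 2 ∈ T) (hT : (-1 : A) ∉ T) :
    ∃ P : Subsemiring A, T ≤ P ∧ (-1 : A) ∉ P ∧ (∀ a, a ∈ P ∨ -a ∈ P) ∧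
      ∀ a b, a * b ∈ P → -(a * b) ∈ P → (a ∈ P ∧ -a ∈ P) ∨ (b ∈ P ∧ -b ∈ P) := by
  obtain ⟨P, hTP, hPmax⟩ := zorn_le_nonempty₀ {P : Subsemiring A | (-1 : A) ∉ P}
    (by
      intro c hcs hc y hy
      refine ⟨sSup c, ?_, fun z hz => le_sSup hz⟩
      rw [Set.mem_ofPred_eq, Subsemiring.mem_sSup_of_directedOn ⟨y, hy⟩ hc.directedOn]
      rintro ⟨s, hs, hs'⟩
      exact hcs hs hs') T hT
  have hP1 : (-1 : A) ∉ P := hPmax.prop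
  have hPsq : ∀ a : A, a ^ 2 ∈ P := fun a => hTP (hsq a)
  have key : ∀ a, a ∉ P → ∃ s ∈ P, ∃ t ∈ P, s + a * t = -1 := by
    intro a ha
    let Q : Subsemiring A :=
      { carrier := {x | ∃ s ∈ P, ∃ t ∈ P, s + a * t = x}
        zero_mem' := ⟨0, P.zero_mem, 0, P.zero_mem, by ring⟩
        one_mem' := ⟨1, P.one_mem, 0, P.zero_mem, by ring⟩
        add_mem' := by
          rintro _ _ ⟨s, hs, t, ht, rfl⟩ ⟨s', hs', t', ht', rfl⟩
          exact ⟨s + s', P.add_mem hs hs', t + t', P.add_mem ht ht', by ring⟩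
        mul_mem' := by
          rintro _ _ ⟨s, hs, t, ht, rfl⟩ ⟨s', hs', t', ht', rfl⟩
          exact ⟨s * s' + a ^ 2 * (t * t'),
            P.add_mem (P.mul_mem hs hs') (P.mul_mem (hPsq a) (P.mul_mem ht ht')),
            s * t' + s' * t, P.add_mem (P.mul_mem hs ht') (P.mul_mem hs' ht), by ring⟩ }
    by_contra hne
    have hPQ : P ≤ Q := fun s hs => ⟨s, hs, 0, P.zero_mem, by ring⟩
    exact ha (hPmax.le_of_ge (y := Q) hne hPQ ⟨0, P.zero_mem, 1, P.one_mem, by ring⟩)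
  have htotal : ∀ a, a ∈ P ∨ -a ∈ P := by
    intro a
    by_contra! h
    obtain ⟨s, hs, t, ht, e⟩ := key a h.1
    obtain ⟨s', hs', t', ht', e'⟩ := key (-a) h.2
    apply hP1
    have : (-1 : A) = s + s' + s * s' + a ^ 2 * (t * t') := by
      linear_combination (-1 - s') * e + (a * t) * e'
    rw [this]
    exact P.add_mem (P.add_mem (P.add_mem hs hs') (P.mul_mem hs hs'))
      (P.mul_mem (hPsq a) (P.mul_mem ht ht'))
  refine ⟨P, hTP, hP1, htotal, fun a b hab hab' => ?_⟩
  have aux : ∀ a b : A, a * b ∈ P → -(a * b) ∈ P → -a ∉ P → -b ∉ P → False := by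
    intro a b hab hab' ha hb
    obtain ⟨s, hs, t, ht, e⟩ := key _ ha
    obtain ⟨s', hs', t', ht', e'⟩ := key _ hb
    apply hP1
    have : (-1 : A) = s + s' + s * s' + -(a * b) * (t * t') := by
      linear_combination (-1 - s') * e - (a * t) * e'
    rw [this]
    exact P.add_mem (P.add_mem (P.add_mem hs hs') (P.mul_mem hs hs'))
      (P.mul_mem hab' (P.mul_mem ht ht'))
  by_contra! h
  by_cases ha : -a ∈ P <;> by_cases hb : -b ∈ P
  · refine aux (-a) (-b) (by simpa) (by simpa) ?_ ?_
    · rw [neg_neg]; exact fun h' => h.1 h' ha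
    · rw [neg_neg]; exact fun h' => h.2 h' hb
  · refine aux (-a) b (by simpa) (by simpa) ?_ hb
    rw [neg_neg]; exact fun h' => h.1 h' ha
  · refine aux a (-b) (by simpa) (by simpa) ha ?_
    rw [neg_neg]; exact fun h' => h.2 h' hb
  · exact aux a b hab hab' ha hb

/-- Polynomials over the ordered field `R` satisfy the intermediate value property. -/
def PolyIVT (R : Type*) [Field R] [LinearOrder R] : Prop :=
  ∀ (f : R[X]) (a b : R), a < b → f.eval a < 0 → 0 < f.eval b → ∃ c, a < c ∧ c < b ∧ f.eval c = 0

/-- The weighted sums of squares of polynomials over an ordered field, with nonnegative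
constants as weights. -/
noncomputable def weightedSquares (k : Type*) [Field k] [LinearOrder k] [IsStrictOrderedRing k] :
    Subsemiring k[X] :=
  Submonoid.subsemiringClosure
    { carrier := {p | ∃ q : k, 0 ≤ q ∧ ∃ h : k[X], p = C q * h ^ 2}
      one_mem' := ⟨1, zero_le_one, 1, by simp⟩
      mul_mem' := by
        rintro _ _ ⟨q, hq, h, rfl⟩ ⟨q', hq', h', rfl⟩
        exact ⟨q * q', mul_nonneg hq hq', h * h', by rw [C_mul]; ring⟩ }

section WeightedSquares

variable {k : Type*} [Field k] [LinearOrder k] [IsStrictOrderedRing k]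

theorem weightedSquares_mem (q : k) (hq : 0 ≤ q) (h : k[X]) :
    C q * h ^ 2 ∈ weightedSquares k :=
  AddSubmonoid.subset_closure ⟨q, hq, h, rfl⟩

theorem weightedSquares_eval_nonneg {p : k[X]} (hp : p ∈ weightedSquares k) (a : k) :
    0 ≤ p.eval a := by
  refine AddSubmonoid.closure_induction (motive := fun p _ => 0 ≤ p.eval a) ?_ ?_ ?_ hp
  · rintro _ ⟨q, hq, h, rfl⟩
    simp only [eval_mul, eval_C, eval_pow]
    positivity
  · simp
  · intro x y _ _ hx hy
    rw [eval_add]; exact add_nonneg hx hy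

theorem weightedSquares_reduce {p : k[X]} (hp : p ∈ weightedSquares k) {f : k[X]}
    (hf : 1 ≤ f.natDegree) :
    ∃ p' ∈ weightedSquares k, p'.natDegree ≤ 2 * (f.natDegree - 1) ∧ f ∣ p - p' := by
  refine AddSubmonoid.closure_induction (motive := fun p _ => ∃ p' ∈ weightedSquares k,
    p'.natDegree ≤ 2 * (f.natDegree - 1) ∧ f ∣ p - p') ?_ ?_ ?_ hp
  · rintro _ ⟨q, hq, h, rfl⟩
    have hdeg : (h % f).natDegree ≤ f.natDegree - 1 := by
      have := natDegree_mod_lt h (q := f) (by omega)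
      omega
    refine ⟨C q * (h % f) ^ 2, weightedSquares_mem q hq _, ?_, ?_⟩
    · refine (natDegree_C_mul_le _ _).trans (natDegree_pow_le.trans ?_)
      omega
    · rw [← mul_sub, sq_sub_sq]
      refine Dvd.dvd.mul_left (Dvd.dvd.mul_left ⟨h / f, ?_⟩ _) _
      linear_combination -(EuclideanDomain.div_add_mod h f)
  · exact ⟨0, zero_mem _, by simp, by simp⟩
  · rintro x y _ _ ⟨p, hp, hpd, hpf⟩ ⟨q, hq, hqd, hqf⟩
    refine ⟨p + q, add_mem hp hq, (natDegree_add_le _ _).trans (max_le hpd hqd), ?_⟩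
    rw [add_sub_add_comm]
    exact dvd_add hpf hqf

/-- A polynomial with a sign change divides no `1 + p` with `p` a weighted sum of squares. -/
theorem not_dvd_one_add_weightedSquares {f : k[X]} {a b : k}
    (hab : f.eval a * f.eval b < 0) {p : k[X]} (hp : p ∈ weightedSquares k) : ¬ f ∣ 1 + p := by
  induction hd : f.natDegree using Nat.strong_induction_on generalizing f p with
  | _ d ih =>
  intro hfp
  have hd1 : 1 ≤ f.natDegree := by
    by_contra! h
    rw [Nat.lt_one_iff] at h
    rw [eq_C_of_natDegree_eq_zero h, eval_C, eval_C] at hab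
    nlinarith
  obtain ⟨p', hp', hpd, hpf⟩ := weightedSquares_reduce hp hd1
  obtain ⟨q, hq⟩ : f ∣ 1 + p' := by
    have : 1 + p' = (1 + p) - (p - p') := by ring
    rw [this]; exact dvd_sub hfp hpf
  have hpos : ∀ x : k, 0 < f.eval x * q.eval x := by
    intro x
    rw [← eval_mul, ← hq, eval_add, eval_one]
    linarith [weightedSquares_eval_nonneg hp' x]
  have hq0 : q ≠ 0 := by
    rintro rfl
    simpa using hpos a
  have hf0 : f ≠ 0 := by
    rintro rfl
    simp at hd1
  have hdeg : (f * q).natDegree ≤ 2 * (f.natDegree - 1) := by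
    rw [← hq]
    refine (natDegree_add_le _ _).trans (max_le ?_ hpd)
    simp
  rw [natDegree_mul hf0 hq0] at hdeg
  refine ih q.natDegree (by omega) ?_ hp' rfl ⟨f, by rw [hq, mul_comm]⟩
  have h1 := mul_pos (hpos a) (hpos b)
  by_contra! h2
  nlinarith

end WeightedSquares

/-- `Q` is the set of nonnegative elements of an ordered subfield of `Ω`. -/
structure IsFieldCone {Ω : Type*} [Field Ω] (Q : Set Ω) : Prop where
  protected zero_mem : (0 : Ω) ∈ Q
  protected one_mem : (1 : Ω) ∈ Q
  protected add_mem : ∀ {x y}, x ∈ Q → y ∈ Q → x + y ∈ Q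
  protected mul_mem : ∀ {x y}, x ∈ Q → y ∈ Q → x * y ∈ Q
  protected inv_mem : ∀ {x}, x ∈ Q → x⁻¹ ∈ Q
  protected eq_zero : ∀ {x}, x ∈ Q → -x ∈ Q → x = 0
  protected sub_mem : ∀ {x y}, x ∈ Q → y ∈ Q → x - y ∈ Q ∨ y - x ∈ Q

namespace IsFieldCone

variable {Ω : Type*} [Field Ω] {Q : Set Ω}

/-- The ordered subfield with a given cone of nonnegative elements. -/
def subfield (h : IsFieldCone Q) : Subfield Ω where
  carrier := {z | z ∈ Q ∨ -z ∈ Q}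
  zero_mem' := Or.inl h.zero_mem
  one_mem' := Or.inl h.one_mem
  neg_mem' := by
    rintro x (hx | hx)
    · right; simpa
    · left; simpa
  inv_mem' := by
    rintro x (hx | hx)
    · exact Or.inl (h.inv_mem hx)
    · right; rw [← inv_neg]; exact h.inv_mem hx
  add_mem' := by
    rintro x y (hx | hx) (hy | hy)
    · exact Or.inl (h.add_mem hx hy)
    · have := h.sub_mem hx hy
      rwa [sub_neg_eq_add, neg_sub_left] at this
    · have := h.sub_mem hy hx
      rwa [sub_neg_eq_add, neg_sub_left, add_comm y x] at this
    · right; rw [neg_add]; exact h.add_mem hx hy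
  mul_mem' := by
    rintro x y (hx | hx) (hy | hy)
    · exact Or.inl (h.mul_mem hx hy)
    · right; rw [← mul_neg]; exact h.mul_mem hx hy
    · right; rw [← neg_mul]; exact h.mul_mem hx hy
    · left; rw [← neg_mul_neg]; exact h.mul_mem hx hy

theorem mem_subfield (h : IsFieldCone Q) {z : Ω} : z ∈ h.subfield ↔ z ∈ Q ∨ -z ∈ Q := Iff.rfl

open Classical in
/-- The linear order on a subfield given by its cone of nonnegative elements. -/
@[reducible]
noncomputable def linearOrder (h : IsFieldCone Q) : LinearOrder h.subfield where
  le x y := (y - x : Ω) ∈ Q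
  le_refl x := by
    rw [sub_self]; exact h.zero_mem
  le_trans x y z hxy hyz := by
    rw [← sub_add_sub_cancel]; exact h.add_mem hyz hxy
  le_antisymm x y hxy hyx := by
    refine Subtype.ext (sub_eq_zero.1 (h.eq_zero hyx ?_))
    rw [neg_sub]; exact hxy
  le_total x y := by
    have := (y - x).2
    rw [mem_subfield] at this
    simpa using this
  toDecidableLE := Classical.decRel _

theorem isStrictOrderedRing (h : IsFieldCone Q) :
    @IsStrictOrderedRing h.subfield _ h.linearOrder.toPartialOrder := by
  let := h.linearOrder
  have : IsOrderedAddMonoid h.subfield :=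
    { add_le_add_left := fun a b hab c => by
        change ((b + c : h.subfield) - (a + c : h.subfield) : Ω) ∈ Q
        have hab' : (b - a : Ω) ∈ Q := hab
        simpa using hab' }
  have : ZeroLEOneClass h.subfield := ⟨by
    change ((1 : h.subfield) - (0 : h.subfield) : Ω) ∈ Q
    simpa using h.one_mem⟩
  refine IsStrictOrderedRing.of_mul_pos fun a b ha hb => ?_
  refine lt_of_le_of_ne ?_ (mul_ne_zero ha.ne' hb.ne').symm
  have h1 : ((a : Ω) - (0 : h.subfield)) ∈ Q := ha.le
  have h2 : ((b : Ω) - (0 : h.subfield)) ∈ Q := hb.le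
  change ((a * b : h.subfield) - (0 : h.subfield) : Ω) ∈ Q
  simp only [ZeroMemClass.coe_zero, sub_zero, MulMemClass.coe_mul] at *
  exact h.mul_mem h1 h2

theorem nonneg_iff (h : IsFieldCone Q) (x : h.subfield) :
    h.linearOrder.le 0 x ↔ (x : Ω) ∈ Q := by
  change ((x : Ω) - (0 : h.subfield)) ∈ Q ↔ _
  simp

/-- A maximal ordered subfield of an algebraically closed field contains a root of every
irreducible polynomial with a sign change. -/
theorem exists_root_of_irreducible [IsAlgClosed Ω] (h : IsFieldCone Q)
    (hmax : ∀ Q', IsFieldCone Q' → Q ⊆ Q' → Q' = Q) {f : h.subfield[X]} (hf : Irreducible f)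
    {a b : h.subfield}
    (hab : h.linearOrder.lt (f.eval a * f.eval b) 0) : ∃ c, f.eval c = 0 := by
  let := h.linearOrder
  have := h.isStrictOrderedRing
  have hT : ∃ T : Subsemiring h.subfield[X], ∀ p, p ∈ T ↔ ∃ t ∈ weightedSquares h.subfield,
      f ∣ p - t :=
    ⟨{ carrier := {p | ∃ t ∈ weightedSquares h.subfield, f ∣ p - t}
       zero_mem' := ⟨0, zero_mem _, by simp⟩
       one_mem' := ⟨1, one_mem _, by simp⟩
       add_mem' := by
        rintro x y ⟨t, ht, hx⟩ ⟨s, hs, hy⟩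
        refine ⟨t + s, add_mem ht hs, ?_⟩
        rw [add_sub_add_comm]; exact dvd_add hx hy
       mul_mem' := by
        rintro x y ⟨t, ht, hx⟩ ⟨s, hs, hy⟩
        refine ⟨t * s, mul_mem ht hs, ?_⟩
        have : x * y - t * s = (x - t) * y + t * (y - s) := by ring
        rw [this]
        exact dvd_add (Dvd.dvd.mul_right hx _) (Dvd.dvd.mul_left hy _) }, fun p => Iff.rfl⟩
  obtain ⟨T, hT⟩ := hT
  have hWT : ∀ t ∈ weightedSquares h.subfield, t ∈ T := fun t ht => (hT t).2 ⟨t, ht, by simp⟩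
  obtain ⟨P, hTP, hP1, htot, -⟩ := exists_primeCone T
    (fun p => hWT _ (by simpa using weightedSquares_mem 1 zero_le_one p))
    (by
      rw [hT]
      rintro ⟨t, ht, hft⟩
      refine not_dvd_one_add_weightedSquares hab ht ?_
      rw [← dvd_neg]
      convert hft using 1
      ring)
  have hfP : ∀ p, f ∣ p → p ∈ P := fun p hp => hTP ((hT p).2 ⟨0, zero_mem _, by simpa using hp⟩)
  obtain ⟨θ, hθ⟩ := IsAlgClosed.exists_aeval_eq_zero Ω f (degree_pos_of_irreducible hf).ne'
  have hdvd : ∀ p : h.subfield[X], aeval θ p = 0 ↔ f ∣ p := by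
    refine fun p => ⟨fun hp => ?_, ?_⟩
    · by_contra hfp
      obtain ⟨u, v, huv⟩ := (hf.coprime_iff_not_dvd.2 hfp)
      simpa [hp, hθ] using congrArg (aeval θ) huv
    · rintro ⟨q, rfl⟩
      rw [map_mul, hθ, zero_mul]
  have hsq : ∀ u : h.subfield[X], u ^ 2 ∈ P := fun u =>
    hTP (hWT _ (by simpa using weightedSquares_mem 1 zero_le_one u))
  have hcone : IsFieldCone {z : Ω | ∃ p ∈ P, aeval θ p = z} :=
    { zero_mem := ⟨0, zero_mem _, by simp⟩
      one_mem := ⟨1, one_mem _, by simp⟩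
      add_mem := by
        rintro _ _ ⟨p, hp, rfl⟩ ⟨q, hq, rfl⟩
        exact ⟨p + q, add_mem hp hq, by simp⟩
      mul_mem := by
        rintro _ _ ⟨p, hp, rfl⟩ ⟨q, hq, rfl⟩
        exact ⟨p * q, mul_mem hp hq, by simp⟩
      inv_mem := by
        rintro _ ⟨p, hp, rfl⟩
        by_cases hfp : f ∣ p
        · exact ⟨0, zero_mem _, by rw [(hdvd p).2 hfp]; simp⟩
        · obtain ⟨u, v, huv⟩ := (hf.coprime_iff_not_dvd.2 hfp)
          have h1 : aeval θ v * aeval θ p = 1 := by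
            simpa [hθ] using congrArg (aeval θ) huv
          refine ⟨v ^ 2 * p, mul_mem (hsq v) hp, ?_⟩
          rw [map_mul, map_pow, pow_two, mul_assoc, h1, mul_one]
          exact eq_inv_of_mul_eq_one_left h1
      eq_zero := by
        rintro _ ⟨p, hp, rfl⟩ ⟨q, hq, hpq⟩
        have hs : f ∣ p + q := by
          rw [← hdvd, map_add, hpq, add_neg_cancel]
        have hp' : -p ∈ P := by
          have : -p = q + -(p + q) := by ring
          rw [this]
          exact add_mem hq (hfP _ (by rwa [dvd_neg]))
        rw [hdvd]
        by_contra hfp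
        obtain ⟨u, v, huv⟩ := (hf.coprime_iff_not_dvd.2 hfp)
        apply hP1
        have : (-1 : h.subfield[X]) = -(u * f) + -(v * p) := by rw [← huv]; ring
        rw [this]
        refine add_mem (hfP _ (by rw [dvd_neg]; exact dvd_mul_left _ _)) ?_
        rcases htot v with hv | hv
        · rw [← mul_neg]; exact mul_mem hv hp'
        · rw [← neg_mul]; exact mul_mem hv hp
      sub_mem := by
        rintro _ _ ⟨p, hp, rfl⟩ ⟨q, hq, rfl⟩
        rcases htot (p - q) with hv | hv
        · exact Or.inl ⟨_, hv, by simp⟩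
        · exact Or.inr ⟨_, hv, by simp⟩ }
  have hQ := hmax _ hcone (by
    intro z hz
    refine ⟨C ⟨z, Or.inl hz⟩, hTP (hWT _ ?_), by rw [aeval_C]; rfl⟩
    simpa using weightedSquares_mem (⟨z, Or.inl hz⟩ : h.subfield)
      ((h.nonneg_iff _).2 hz) 1)
  have hθmem : θ ∈ h.subfield := by
    rw [mem_subfield, ← hQ]
    rcases htot X with hX | hX
    · exact Or.inl ⟨X, hX, by simp⟩
    · exact Or.inr ⟨-X, hX, by simp⟩
  refine ⟨⟨θ, hθmem⟩, Subtype.ext ?_⟩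
  rw [aeval_def, show θ = algebraMap h.subfield Ω ⟨θ, hθmem⟩ from rfl, eval₂_at_apply] at hθ
  exact hθ

theorem polyIVT [IsAlgClosed Ω] (h : IsFieldCone Q)
    (hmax : ∀ Q', IsFieldCone Q' → Q ⊆ Q' → Q' = Q) : @PolyIVT h.subfield _ h.linearOrder := by
  let := h.linearOrder
  have := h.isStrictOrderedRing
  intro f a b hlt ha hb
  have hab : f.eval a * f.eval b < 0 := mul_neg_of_neg_of_pos ha hb
  clear ha hb
  induction f using WfDvdMonoid.induction_on_irreducible with
  | zero => simp at hab
  | unit u hu =>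
    obtain ⟨c, -, rfl⟩ := Polynomial.isUnit_iff.1 hu
    rw [eval_C, eval_C] at hab
    exact absurd hab (not_lt.2 (mul_self_nonneg c))
  | mul f p hf0 hp ih =>
    by_cases hpab : p.eval a * p.eval b < 0
    · obtain ⟨c, hc⟩ := h.exists_root_of_irreducible hmax hp hpab
      have hdvd : X - C c ∣ p := dvd_iff_isRoot.2 hc
      obtain ⟨q, hq⟩ := hdvd
      have hqu : IsUnit q := (hp.isUnit_or_isUnit hq).resolve_left (not_isUnit_X_sub_C c)
      obtain ⟨u, hu, rfl⟩ := Polynomial.isUnit_iff.1 hqu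
      rw [hq] at hpab
      simp only [eval_mul, eval_sub, eval_X, eval_C] at hpab
      have h1 : (a - c) * (b - c) < 0 := by
        by_contra! h1
        nlinarith [mul_nonneg h1 (mul_self_nonneg u)]
      refine ⟨c, ?_, ?_, by rw [eval_mul, hc, zero_mul]⟩
      · by_contra! h2
        nlinarith
      · by_contra! h2
        nlinarith
    · obtain ⟨c, hac, hcb, hc⟩ := ih (by
        rw [eval_mul, eval_mul] at hab
        by_contra! h1
        push Not at hpab
        nlinarith [mul_nonneg h1 hpab])
      exact ⟨c, hac, hcb, by rw [eval_mul, hc, mul_zero]⟩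

end IsFieldCone

universe u in
/-- An ordering of a commutative ring is induced by a homomorphism to an ordered field with
the intermediate value property for polynomials. -/
theorem exists_ordered_field_of_primeCone {A : Type u} [CommRing A] (P : Subsemiring A)
    (hP1 : (-1 : A) ∉ P) (htot : ∀ a, a ∈ P ∨ -a ∈ P)
    (hprime : ∀ a b, a * b ∈ P → -(a * b) ∈ P → (a ∈ P ∧ -a ∈ P) ∨ (b ∈ P ∧ -b ∈ P)) :
    ∃ (R : Type u) (_ : Field R) (_ : LinearOrder R) (_ : IsStrictOrderedRing R) (φ : A →+* R),
      PolyIVT R ∧ ∀ a ∈ P, 0 ≤ φ a := by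
  let I : Ideal A :=
    { carrier := {a | a ∈ P ∧ -a ∈ P}
      zero_mem' := ⟨zero_mem _, by simp⟩
      add_mem' := by
        rintro x y ⟨hx, hx'⟩ ⟨hy, hy'⟩
        exact ⟨add_mem hx hy, by rw [neg_add]; exact add_mem hx' hy'⟩
      smul_mem' := by
        rintro c x ⟨hx, hx'⟩
        rw [smul_eq_mul]
        rcases htot c with hc | hc
        · exact ⟨mul_mem hc hx, by rw [← mul_neg]; exact mul_mem hc hx'⟩
        · exact ⟨by rw [← neg_mul_neg]; exact mul_mem hc hx',
            by rw [← neg_mul]; exact mul_mem hc hx⟩ }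
  have hI : I.IsPrime := by
    refine ⟨fun h => hP1 ?_, fun {a b} hab => hprime a b hab.1 hab.2⟩
    exact ((Ideal.eq_top_iff_one I).1 h).2
  obtain ⟨Ω, _, _, ι, hι⟩ : ∃ (Ω : Type u) (_ : Field Ω) (_ : IsAlgClosed Ω) (ι : A →+* Ω),
      ∀ a, ι a = 0 ↔ a ∈ P ∧ -a ∈ P := by
    refine ⟨AlgebraicClosure (FractionRing (A ⧸ I)), inferInstance, inferInstance,
      (algebraMap (FractionRing (A ⧸ I)) _).comp
        ((algebraMap (A ⧸ I) (FractionRing (A ⧸ I))).comp (Ideal.Quotient.mk I)), fun a => ?_⟩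
    rw [RingHom.comp_apply, RingHom.comp_apply, map_eq_zero,
      map_eq_zero_iff _ (IsFractionRing.injective (A ⧸ I) _), Ideal.Quotient.eq_zero_iff_mem]
    exact Iff.rfl
  have hsq : ∀ a : A, a ^ 2 ∈ P := by
    intro a
    rcases htot a with ha | ha
    · exact pow_mem ha 2
    · rw [← neg_sq]; exact pow_mem ha 2
  have hcone : IsFieldCone {z : Ω | ∃ a ∈ P, ∃ d, ι d ≠ 0 ∧ z = ι a / ι d ^ 2} :=
    { zero_mem := ⟨0, zero_mem _, 1, by simp⟩
      one_mem := ⟨1, one_mem _, 1, by simp⟩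
      add_mem := by
        rintro _ _ ⟨a, ha, d, hd, rfl⟩ ⟨b, hb, e, he, rfl⟩
        refine ⟨a * e ^ 2 + b * d ^ 2, add_mem (mul_mem ha (hsq e)) (mul_mem hb (hsq d)), d * e,
          by rw [map_mul]; exact mul_ne_zero hd he, ?_⟩
        simp only [map_add, map_mul, map_pow]
        field_simp
      mul_mem := by
        rintro _ _ ⟨a, ha, d, hd, rfl⟩ ⟨b, hb, e, he, rfl⟩
        refine ⟨a * b, mul_mem ha hb, d * e, by rw [map_mul]; exact mul_ne_zero hd he, ?_⟩
        simp only [map_mul]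
        field_simp
      inv_mem := by
        rintro _ ⟨a, ha, d, hd, rfl⟩
        by_cases ha0 : ι a = 0
        · exact ⟨0, zero_mem _, 1, by simp, by simp [ha0]⟩
        · refine ⟨a * d ^ 2, mul_mem ha (hsq d), a, ha0, ?_⟩
          simp only [map_mul, map_pow]
          field_simp
      eq_zero := by
        rintro _ ⟨a, ha, d, hd, rfl⟩ ⟨b, hb, e, he, hab⟩
        have h0 : ι (a * e ^ 2 + b * d ^ 2) = 0 := by
          simp only [map_add, map_mul, map_pow]
          field_simp at hab
          linear_combination -hab
        have h1 : ι (a * e ^ 2) = 0 := by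
          rw [hι] at h0 ⊢
          refine ⟨mul_mem ha (hsq e), ?_⟩
          have : -(a * e ^ 2) = b * d ^ 2 + -(a * e ^ 2 + b * d ^ 2) := by ring
          rw [this]
          exact add_mem (mul_mem hb (hsq d)) h0.2
        have h2 : ι a = 0 := by simpa [he] using h1
        rw [h2, zero_div]
      sub_mem := by
        rintro _ _ ⟨a, ha, d, hd, rfl⟩ ⟨b, hb, e, he, rfl⟩
        rcases htot (a * e ^ 2 - b * d ^ 2) with h | h
        · left
          refine ⟨_, h, d * e, by rw [map_mul]; exact mul_ne_zero hd he, ?_⟩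
          simp only [map_sub, map_mul, map_pow]
          field_simp
        · right
          refine ⟨_, h, d * e, by rw [map_mul]; exact mul_ne_zero hd he, ?_⟩
          simp only [map_neg, map_sub, map_mul, map_pow]
          field_simp
          ring }
  obtain ⟨Q, hQ0, hQmax⟩ := zorn_subset_nonempty {Q : Set Ω | IsFieldCone Q}
    (by
      intro c hcs hc ⟨y, hy⟩
      have hdir := hc.directedOn
      refine ⟨⋃₀ c, ?_, fun s hs => Set.subset_sUnion_of_mem hs⟩
      have two : ∀ {x y : Ω}, x ∈ ⋃₀ c → y ∈ ⋃₀ c → ∃ s ∈ c, x ∈ s ∧ y ∈ s := by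
        rintro x y ⟨s, hs, hxs⟩ ⟨t, ht, hyt⟩
        obtain ⟨r, hr, hsr, htr⟩ := hdir s hs t ht
        exact ⟨r, hr, hsr hxs, htr hyt⟩
      exact
        { zero_mem := ⟨y, hy, (hcs hy).zero_mem⟩
          one_mem := ⟨y, hy, (hcs hy).one_mem⟩
          add_mem := fun hx hy => by
            obtain ⟨s, hs, h1, h2⟩ := two hx hy
            exact ⟨s, hs, (hcs hs).add_mem h1 h2⟩
          mul_mem := fun hx hy => by
            obtain ⟨s, hs, h1, h2⟩ := two hx hy
            exact ⟨s, hs, (hcs hs).mul_mem h1 h2⟩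
          inv_mem := fun hx => by
            obtain ⟨s, hs, h1⟩ := hx
            exact ⟨s, hs, (hcs hs).inv_mem h1⟩
          eq_zero := fun hx hy => by
            obtain ⟨s, hs, h1, h2⟩ := two hx hy
            exact (hcs hs).eq_zero h1 h2
          sub_mem := fun hx hy => by
            obtain ⟨s, hs, h1, h2⟩ := two hx hy
            exact ((hcs hs).sub_mem h1 h2).imp (fun h => ⟨s, hs, h⟩) (fun h => ⟨s, hs, h⟩) })
    _ hcone
  have hQ : IsFieldCone Q := hQmax.prop
  have hPQ : ∀ a ∈ P, ι a ∈ Q := fun a ha => hQ0 ⟨a, ha, 1, by simp, by simp⟩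
  refine ⟨hQ.subfield, inferInstance, hQ.linearOrder, hQ.isStrictOrderedRing,
    ι.codRestrict hQ.subfield fun a => ?_, hQ.polyIVT fun Q' hQ' hle => ?_, fun a ha => ?_⟩
  · rcases htot a with ha | ha
    · exact Or.inl (hPQ a ha)
    · right
      rw [← map_neg]
      exact hPQ _ ha
  · exact (hQmax.eq_of_le hQ' hle).symm
  · exact (hQ.nonneg_iff _).2 (hPQ a ha)

section IntermediateValue

variable {R : Type*} [Field R] [LinearOrder R] [IsStrictOrderedRing R]

theorem PolyIVT.exists_root_between (hR : PolyIVT R) (f : R[X]) {a b : R}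
    (hab : f.eval a * f.eval b < 0) : ∃ c, f.eval c = 0 ∧ min a b < c ∧ c < max a b := by
  have key : ∀ a b : R, a < b → f.eval a * f.eval b < 0 → ∃ c, f.eval c = 0 ∧ a < c ∧ c < b := by
    intro a b hlt hab
    rcases mul_neg_iff.1 hab with ⟨h1, h2⟩ | ⟨h1, h2⟩
    · obtain ⟨c, hc1, hc2, hc⟩ := hR (-f) a b hlt (by simpa using h1) (by simpa using h2)
      exact ⟨c, by simpa using hc, hc1, hc2⟩
    · obtain ⟨c, hc1, hc2, hc⟩ := hR f a b hlt h1 h2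
      exact ⟨c, hc, hc1, hc2⟩
  rcases lt_trichotomy a b with h | rfl | h
  · rw [min_eq_left h.le, max_eq_right h.le]
    exact key a b h hab
  · exact absurd hab (not_lt.2 (mul_self_nonneg _))
  · rw [min_eq_right h.le, max_eq_left h.le]
    exact key b a h (by rwa [mul_comm])

/-- A form of Rolle's theorem: a polynomial with a zero between two points at which it is
positive has a critical point between these points. -/
theorem PolyIVT.exists_derivative_eq_zero (hR : PolyIVT R) (f : R[X]) {a r b : R} (har : a < r)
    (hrb : r < b) (ha : 0 < f.eval a) (hb : 0 < f.eval b) (hr : f.eval r = 0) :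
    ∃ c, a < c ∧ c < b ∧ f.derivative.eval c = 0 := by
  have hf0 : f ≠ 0 := by
    rintro rfl
    simp at ha
  let S := f.roots.toFinset.filter fun c => a < c ∧ c < b
  have hS : ∀ c, c ∈ S ↔ f.eval c = 0 ∧ a < c ∧ c < b := by
    intro c
    simp [S, hf0]
  have hne : S.Nonempty := ⟨r, (hS r).2 ⟨hr, har, hrb⟩⟩
  obtain ⟨h1, h1a, h1b⟩ := (hS _).1 (S.min'_mem hne)
  obtain ⟨h2, h2a, h2b⟩ := (hS _).1 (S.max'_mem hne)
  set s := S.min' hne with hs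
  set t := S.max' hne with ht
  have hst : s ≤ t := S.min'_le _ (S.max'_mem hne)
  have hder : ∀ (c : R) (q : R[X]), f = (X - C c) * q → f.derivative.eval c = q.eval c := by
    rintro c q rfl
    simp
  have hs' : f.derivative.eval s ≤ 0 := by
    obtain ⟨q, hq⟩ := dvd_iff_isRoot.2 h1
    rw [hder s q hq]
    by_contra! hpos
    have hqa : q.eval a < 0 := by
      rw [hq] at ha
      simp only [eval_mul, eval_sub, eval_X, eval_C] at ha
      by_contra! h
      nlinarith
    obtain ⟨c, hc1, hc2, hc⟩ := hR q a s h1a hqa hpos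
    exact absurd (S.min'_le c ((hS c).2 ⟨by rw [hq, eval_mul, hc, mul_zero], hc1, hc2.trans h1b⟩))
      (not_le.2 hc2)
  have ht' : 0 ≤ f.derivative.eval t := by
    obtain ⟨q, hq⟩ := dvd_iff_isRoot.2 h2
    rw [hder t q hq]
    by_contra! hneg
    have hqb : 0 < q.eval b := by
      rw [hq] at hb
      simp only [eval_mul, eval_sub, eval_X, eval_C] at hb
      by_contra! h
      nlinarith
    obtain ⟨c, hc1, hc2, hc⟩ := hR q t b h2b hneg hqb
    exact absurd (S.le_max' c ((hS c).2 ⟨by rw [hq, eval_mul, hc, mul_zero], h2a.trans hc1, hc2⟩))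
      (not_le.2 hc1)
  rcases hs'.eq_or_lt with h | hs'
  · exact ⟨s, h1a, h1b, h⟩
  rcases ht'.eq_or_lt with h | ht'
  · exact ⟨t, h2a, h2b, h.symm⟩
  have hlt : s < t := by
    refine lt_of_le_of_ne hst fun h => ?_
    rw [h] at hs'
    exact absurd hs' (not_lt.2 ht'.le)
  obtain ⟨c, hc1, hc2, hc⟩ := hR _ s t hlt hs' ht'
  exact ⟨c, h1a.trans hc1, hc2.trans h2b, hc⟩

variable {k : Type*} [Field k] [LinearOrder k] [IsStrictOrderedRing k]

/-- The roots of a polynomial over an ordered field in an ordered extension are bounded by an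
element of the ground field. -/
theorem exists_root_bound (φ : k →+* R) (hφ : StrictMono φ) (f : k[X]) (hf : f ≠ 0) :
    ∃ B : k, ∀ y, (f.map φ).eval y = 0 → φ (-B) < y ∧ y < φ B := by
  let B : k := 1 + ∑ i ∈ Finset.range f.natDegree, |f.coeff i / f.leadingCoeff|
  refine ⟨B, fun y hy => ?_⟩
  suffices h : |y| < φ B by
    rw [map_neg]
    exact abs_lt.1 h
  have hlc : φ f.leadingCoeff ≠ 0 := by simpa using hf
  have hB : φ B = 1 + ∑ i ∈ Finset.range f.natDegree, |φ (f.coeff i) / φ f.leadingCoeff| := by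
    have habs : ∀ a : k, φ |a| = |φ a| := fun a => by
      rw [abs_eq_max_neg, abs_eq_max_neg, hφ.monotone.map_max, map_neg]
    simp only [B, map_add, map_one, map_sum, habs, map_div₀]
  by_contra! hle
  rw [eval_map, eval₂_eq_sum_range, Finset.sum_range_succ] at hy
  have hy' : y ^ f.natDegree =
      -∑ i ∈ Finset.range f.natDegree, φ (f.coeff i) / φ f.leadingCoeff * y ^ i := by
    have : φ f.leadingCoeff * (y ^ f.natDegree +
      ∑ i ∈ Finset.range f.natDegree, φ (f.coeff i) / φ f.leadingCoeff * y ^ i) = 0 := by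
      rw [mul_add, Finset.mul_sum, ← hy, add_comm]
      congr 1
      refine Finset.sum_congr rfl fun i _ => ?_
      field_simp
    linear_combination (mul_eq_zero.1 this).resolve_left hlc
  have h1 : 1 ≤ |y| := by
    refine le_trans ?_ hle
    rw [hB, le_add_iff_nonneg_right]
    exact Finset.sum_nonneg fun _ _ => abs_nonneg _
  have h2 : |y| ^ f.natDegree ≤ (φ B - 1) * |y| ^ (f.natDegree - 1) := by
    rw [← abs_pow, hy', abs_neg, hB, add_sub_cancel_left, Finset.sum_mul]
    refine (Finset.abs_sum_le_sum_abs _ _).trans (Finset.sum_le_sum fun i hi => ?_)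
    rw [abs_mul, abs_pow]
    refine mul_le_mul_of_nonneg_left (pow_le_pow_right₀ h1 ?_) (abs_nonneg _)
    have := Finset.mem_range.1 hi
    omega
  rcases Nat.eq_zero_or_pos f.natDegree with h0 | h0
  · simp [h0] at hy'
  · obtain ⟨m, hm⟩ : ∃ m, f.natDegree = m + 1 := ⟨f.natDegree - 1, by omega⟩
    rw [hm, Nat.add_sub_cancel, pow_succ, mul_comm] at h2
    have h3 := le_of_mul_le_mul_right h2 (pow_pos (zero_lt_one.trans_le h1) m)
    linarith

/-- If the ordered field `k` has the intermediate value property for polynomials of degree less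
than `D`, then polynomials of degree less than `D` acquire no new roots in ordered extensions. -/
theorem exists_root_of_map_root (φ : k →+* R) (hφ : StrictMono φ) (hR : PolyIVT R) {D : ℕ}
    (hk : ∀ f : k[X], f.natDegree < D → ∀ a b, a < b → f.eval a < 0 → 0 < f.eval b →
      ∃ c, f.eval c = 0)
    (h : k[X]) (h0 : h ≠ 0) (hD : h.natDegree < D) (r : R) (hr : (h.map φ).eval r = 0) :
    ∃ c, h.eval c = 0 ∧ φ c = r := by
  induction hd : h.natDegree using Nat.strong_induction_on generalizing h r with
  | _ d ih =>
  by_cases hroot : ∃ c, h.eval c = 0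
  · obtain ⟨c, hc⟩ := hroot
    by_cases hcr : φ c = r
    · exact ⟨c, hc, hcr⟩
    obtain ⟨q, rfl⟩ := dvd_iff_isRoot.2 hc
    have hq0 : q ≠ 0 := right_ne_zero_of_mul h0
    rw [natDegree_mul (X_sub_C_ne_zero c) hq0, natDegree_X_sub_C] at hd hD
    rw [Polynomial.map_mul, eval_mul] at hr
    have hr' : (q.map φ).eval r = 0 := by
      refine (mul_eq_zero.1 hr).resolve_left ?_
      simpa [sub_eq_zero] using fun h => hcr h.symm
    obtain ⟨c', hc', hcr'⟩ := ih q.natDegree (by omega) q hq0 (by omega) r hr' rfl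
    exact ⟨c', by rw [eval_mul, hc', mul_zero], hcr'⟩
  exfalso
  have main : ∀ h : k[X], h.natDegree = d → h.natDegree < D → (h.map φ).eval r = 0 →
      (∀ c, h.eval c ≠ 0) → 0 < h.eval 0 → False := by
    intro h hd hD hr hroot h0pos
    have hh0 : h ≠ 0 := by
      rintro rfl
      simp at h0pos
    have hpos : ∀ c, 0 < h.eval c := by
      intro c
      by_contra! hc
      have hc := lt_of_le_of_ne hc (hroot c)
      rcases lt_trichotomy c 0 with h1 | rfl | h1
      · obtain ⟨e, he⟩ := hk h hD c 0 h1 hc h0pos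
        exact hroot e he
      · exact absurd hc h0pos.asymm
      · obtain ⟨e, he⟩ := hk (-h) (by simpa using hD) 0 c h1 (by simpa using h0pos)
          (by simpa using hc)
        exact hroot e (by simpa using he)
    have hd0 : h.natDegree ≠ 0 := by
      intro hdeg
      rw [eq_C_of_natDegree_eq_zero hdeg] at hr h0pos
      rw [map_C, eval_C, map_eq_zero] at hr
      rw [eval_C, hr] at h0pos
      exact lt_irrefl _ h0pos
    have hder0 : h.derivative ≠ 0 := fun hz => hd0 (Polynomial.derivative_eq_zero.1 hz)
    have hderd : h.derivative.natDegree < h.natDegree := natDegree_derivative_lt hd0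
    obtain ⟨B, hB⟩ := exists_root_bound φ hφ h hh0
    obtain ⟨hB1, hB2⟩ := hB r hr
    let L := insert (-B) (h.derivative.roots.toFinset.filter fun c => φ c < r)
    let U := insert B (h.derivative.roots.toFinset.filter fun c => r < φ c)
    have hL : L.Nonempty := Finset.insert_nonempty _ _
    have hU : U.Nonempty := Finset.insert_nonempty _ _
    have hLr : φ (L.max' hL) < r := by
      rcases Finset.mem_insert.1 (L.max'_mem hL) with h | h
      · rw [h]; exact hB1
      · exact (Finset.mem_filter.1 h).2
    have hUr : r < φ (U.min' hU) := by
      rcases Finset.mem_insert.1 (U.min'_mem hU) with h | h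
      · rw [h]; exact hB2
      · exact (Finset.mem_filter.1 h).2
    have hevalpos : ∀ c, 0 < (h.map φ).eval (φ c) := by
      intro c
      rw [eval_map_apply, ← map_zero φ]
      exact hφ (hpos c)
    obtain ⟨c, hc1, hc2, hc⟩ := hR.exists_derivative_eq_zero (h.map φ) hLr hUr (hevalpos _)
      (hevalpos _) hr
    rw [derivative_map] at hc
    obtain ⟨e, he, rfl⟩ := ih _ (by omega) h.derivative hder0 (by omega) c hc rfl
    have hmem : e ∈ h.derivative.roots.toFinset := by simpa [hder0] using he
    rcases lt_trichotomy (φ e) r with h1 | rfl | h1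
    · exact absurd (hφ.monotone (L.le_max' e
        (Finset.mem_insert_of_mem (Finset.mem_filter.2 ⟨hmem, h1⟩)))) (not_le.2 hc1)
    · rw [eval_map_apply, map_eq_zero] at hr
      exact hroot e hr
    · exact absurd (hφ.monotone (U.min'_le e
        (Finset.mem_insert_of_mem (Finset.mem_filter.2 ⟨hmem, h1⟩)))) (not_le.2 hc2)
  push Not at hroot
  rcases lt_or_gt_of_ne (hroot 0) with h1 | h1
  · exact main (-h) (by simpa using hd) (by simpa using hD) (by simpa using hr)
      (by simpa using hroot) (by simpa using h1)
  · exact main h hd hD hr hroot h1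

/-- If no root of `h` in `k` separates the point `x` of the ordered extension `R` from the element
`m` of `k`, then `h` has the same sign at `x` and at `m`. -/
theorem mul_pos_of_no_root_between (φ : k →+* R) (hφ : StrictMono φ) (hR : PolyIVT R) {D : ℕ}
    (hk : ∀ f : k[X], f.natDegree < D → ∀ a b, a < b → f.eval a < 0 → 0 < f.eval b →
      ∃ c, f.eval c = 0)
    (h : k[X]) (h0 : h ≠ 0) (hD : h.natDegree < D) (x : R) (m : k)
    (hm : ∀ c, h.eval c = 0 → (c < m ∧ φ c < x) ∨ (m < c ∧ x < φ c)) :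
    0 < (h.map φ).eval x * φ (h.eval m) := by
  rcases lt_trichotomy 0 ((h.map φ).eval x * φ (h.eval m)) with h1 | h1 | h1
  · exact h1
  · exfalso
    rcases mul_eq_zero.1 h1.symm with h2 | h2
    · obtain ⟨c, hc, rfl⟩ := exists_root_of_map_root φ hφ hR hk h h0 hD x h2
      rcases hm c hc with h3 | h3
      · exact lt_irrefl _ h3.2
      · exact lt_irrefl _ h3.2
    · rw [map_eq_zero] at h2
      rcases hm m h2 with h3 | h3
      · exact lt_irrefl _ h3.1
      · exact lt_irrefl _ h3.1
  · exfalso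
    rw [← eval_map_apply] at h1
    obtain ⟨y, hy, hy1, hy2⟩ := hR.exists_root_between _ h1
    obtain ⟨c, hc, rfl⟩ := exists_root_of_map_root φ hφ hR hk h h0 hD y hy
    rcases hm c hc with h3 | h3
    · exact absurd hy1 (not_lt.2 (le_min h3.2.le (hφ.monotone h3.1.le)))
    · exact absurd hy2 (not_lt.2 (max_le h3.2.le (hφ.monotone h3.1.le)))

/-- Points of two ordered extensions of `k` which realize the same cut of `k` give the same sign
to polynomials over `k`. -/
theorem eval_pos_of_same_cut {R' : Type*} [Field R'] [LinearOrder R'] [IsStrictOrderedRing R']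
    (φ : k →+* R) (hφ : StrictMono φ) (hR : PolyIVT R)
    (ψ : k →+* R') (hψ : StrictMono ψ) (hR' : PolyIVT R') {D : ℕ}
    (hk : ∀ f : k[X], f.natDegree < D → ∀ a b, a < b → f.eval a < 0 → 0 < f.eval b →
      ∃ c, f.eval c = 0)
    {x : R} {x' : R'} (hx : ∀ c, φ c ≠ x) (hlt : ∀ c, φ c < x → ψ c < x')
    (hgt : ∀ c, x < φ c → x' < ψ c) (h : k[X]) (hD : h.natDegree < D)
    (hpos : 0 < (h.map φ).eval x) : 0 < (h.map ψ).eval x' := by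
  have h0 : h ≠ 0 := by
    rintro rfl
    simp at hpos
  obtain ⟨m, hm1, hm2⟩ := Order.exists_between_finsets
    (lo := h.roots.toFinset.filter fun c => φ c < x)
    (hi := h.roots.toFinset.filter fun c => x < φ c) (by
      intro a ha b hb
      exact hφ.lt_iff_lt.1 ((Finset.mem_filter.1 ha).2.trans (Finset.mem_filter.1 hb).2))
  have hm : ∀ c, h.eval c = 0 → (c < m ∧ φ c < x) ∨ (m < c ∧ x < φ c) := by
    intro c hc
    have hmem : c ∈ h.roots.toFinset := by simpa [h0] using hc
    rcases lt_or_gt_of_ne (hx c) with h1 | h1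
    · exact Or.inl ⟨hm1 c (Finset.mem_filter.2 ⟨hmem, h1⟩), h1⟩
    · exact Or.inr ⟨hm2 c (Finset.mem_filter.2 ⟨hmem, h1⟩), h1⟩
  have h1 := mul_pos_of_no_root_between φ hφ hR hk h h0 hD x m hm
  have h2 := mul_pos_of_no_root_between ψ hψ hR' hk h h0 hD x' m fun c hc =>
    (hm c hc).imp (And.imp_right (hlt c)) (And.imp_right (hgt c))
  have h3 := pos_of_mul_pos_right h1 hpos.le
  rw [← map_zero φ, hφ.lt_iff_lt] at h3
  have h4 := hψ h3
  rw [map_zero] at h4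
  exact pos_of_mul_pos_left h2 h4.le

end IntermediateValue

section Ultrapower

open Filter

variable {R : Type*} [Field R] [LinearOrder R] {I : Type*} (U : Ultrafilter I)

/-- The diagonal embedding of a ring into its ultrapower. -/
def ultrapowerDiag (R : Type*) [CommRing R] : R →+* Germ (U : Filter I) R :=
  (Germ.coeRingHom (U : Filter I)).comp (Pi.constRingHom I R)

theorem PolyIVT.germ (hR : PolyIVT R) : PolyIVT (Germ (U : Filter I) R) := by
  intro f a b hab ha hb
  obtain ⟨F, rfl⟩ := Polynomial.map_surjective (Germ.coeRingHom (U : Filter I))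
    (fun x => x.inductionOn fun f => ⟨f, rfl⟩) f
  induction a using Germ.inductionOn with | _ a
  induction b using Germ.inductionOn with | _ b
  have key : ∀ c : I → R, (F.map (Germ.coeRingHom (U : Filter I))).eval (c : Germ (U : Filter I) R)
      = ((fun i => (F.map (Pi.evalRingHom _ i)).eval (c i) : I → R) : Germ (U : Filter I) R) := by
    intro c
    refine (eval_map_apply (Germ.coeRingHom (U : Filter I)) c).trans (congrArg _ ?_)
    funext i
    exact (eval_map_apply (Pi.evalRingHom (fun _ => R) i) c).symm
  rw [key] at ha hb
  have ha' : ∀ᶠ i in (U : Filter I), (F.map (Pi.evalRingHom _ i)).eval (a i) < 0 := Germ.coe_lt.1 ha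
  have hb' : ∀ᶠ i in (U : Filter I), 0 < (F.map (Pi.evalRingHom _ i)).eval (b i) := Germ.coe_lt.1 hb
  have hex : ∀ i, ∃ c, a i < b i → (F.map (Pi.evalRingHom _ i)).eval (a i) < 0 →
      0 < (F.map (Pi.evalRingHom _ i)).eval (b i) →
      a i < c ∧ c < b i ∧ (F.map (Pi.evalRingHom _ i)).eval c = 0 := by
    intro i
    by_cases h : a i < b i ∧ (F.map (Pi.evalRingHom _ i)).eval (a i) < 0 ∧
      0 < (F.map (Pi.evalRingHom _ i)).eval (b i)
    · obtain ⟨c, hc⟩ := hR _ _ _ h.1 h.2.1 h.2.2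
      exact ⟨c, fun _ _ _ => hc⟩
    · exact ⟨0, fun h1 h2 h3 => absurd ⟨h1, h2, h3⟩ h⟩
  choose c hc using hex
  have hall : ∀ᶠ i in (U : Filter I), a i < c i ∧ c i < b i ∧
      (F.map (Pi.evalRingHom _ i)).eval (c i) = 0 := by
    filter_upwards [Germ.coe_lt.1 hab, ha', hb'] with i h1 h2 h3 using hc i h1 h2 h3
  refine ⟨c, Germ.coe_lt.2 (hall.mono fun _ h => h.1),
    Germ.coe_lt.2 (hall.mono fun _ h => h.2.1), ?_⟩
  rw [key]
  exact Germ.coe_eq.2 (hall.mono fun _ h => h.2.2)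

/-- Every finite system of nonstrict polynomial inequalities with real coefficients which is
solvable in `R` is solvable in `ℝ`. -/
def Realizes (ι : ℝ →+* R) : Prop :=
  ∀ (n : ℕ) (s : Finset (MvPolynomial (Fin n) ℝ)) (v : Fin n → R),
    (∀ p ∈ s, 0 ≤ MvPolynomial.eval₂ ι v p) → ∃ w : Fin n → ℝ, ∀ p ∈ s, 0 ≤ MvPolynomial.eval w p

theorem Realizes.germ {ι : ℝ →+* R} (h : Realizes ι) :
    Realizes ((ultrapowerDiag U R).comp ι) := by
  intro n s v hv
  choose a ha using fun j => (v j).inductionOn (p := fun x => ∃ a : I → R, (a : Germ _ R) = x)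
    fun f => ⟨f, rfl⟩
  obtain rfl : (fun j => (a j : Germ (U : Filter I) R)) = v := funext ha
  have key : ∀ p ∈ s, ∀ᶠ i in (U : Filter I), 0 ≤ MvPolynomial.eval₂ ι (fun j => a j i) p := by
    intro p hp
    have h1 : MvPolynomial.eval₂ ((ultrapowerDiag U R).comp ι)
        (fun j => (a j : Germ (U : Filter I) R)) p =
        Germ.coeRingHom (U : Filter I) (MvPolynomial.eval₂ ((Pi.constRingHom I R).comp ι) a p) := by
      rw [MvPolynomial.hom_eval₂]
      rfl
    have h2 : ((fun _ => 0 : I → R) : Germ (U : Filter I) R) ≤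
        ((MvPolynomial.eval₂ ((Pi.constRingHom I R).comp ι) a p : I → R) : Germ (U : Filter I) R) :=
      (hv p hp).trans_eq h1
    refine (Germ.coe_le.1 h2).mono fun i hi => ?_
    have h3 : MvPolynomial.eval₂ ((Pi.constRingHom I R).comp ι) a p i =
        MvPolynomial.eval₂ ι (fun j => a j i) p :=
      MvPolynomial.hom_eval₂ p ((Pi.constRingHom I R).comp ι) (Pi.evalRingHom (fun _ => R) i) a
    rw [← h3]
    exact hi
  obtain ⟨i, hi⟩ := ((Filter.eventually_all_finset s).2 key).exists
  exact h n s _ hi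

theorem polyIVT_real : PolyIVT ℝ := by
  intro f a b hab ha hb
  obtain ⟨c, hc, hc0⟩ := intermediate_value_Ioo hab.le f.continuousOn ⟨ha, hb⟩
  exact ⟨c, hc.1, hc.2, hc0⟩

theorem realizes_id : Realizes (RingHom.id ℝ) := fun _ _ v hv => ⟨v, hv⟩

end Ultrapower

universe u v

section SignCompatible

variable {R' : Type*} [Field R'] [LinearOrder R'] [IsStrictOrderedRing R']
  {R : Type*} [Field R] [LinearOrder R] [IsStrictOrderedRing R]

/-- A subring of `R × R'` whose elements have the same sign in both components, that is, an
isomorphism between ordered subrings of `R` and `R'`. -/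
def SignCompatible (Γ : Subring (R × R')) : Prop :=
  ∀ p ∈ Γ, 0 ≤ p.1 ↔ 0 ≤ p.2

theorem SignCompatible.pos_iff {Γ : Subring (R × R')} (h : SignCompatible Γ) {p : R × R'}
    (hp : p ∈ Γ) : 0 < p.1 ↔ 0 < p.2 := by
  have := h (-p) (neg_mem hp)
  simp only [Prod.fst_neg, Prod.snd_neg, Left.nonneg_neg_iff] at this
  exact not_le.symm.trans ((not_congr this).trans not_le)

theorem SignCompatible.fst_eq_zero_iff {Γ : Subring (R × R')} (h : SignCompatible Γ) {p : R × R'}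
    (hp : p ∈ Γ) : p.1 = 0 ↔ p.2 = 0 := by
  have h1 := h p hp
  have h2 := h.pos_iff hp
  constructor <;> intro h0
  · rw [h0] at h1 h2
    exact le_antisymm (not_lt.1 fun h => lt_irrefl _ (h2.2 h)) (h1.1 le_rfl)
  · rw [h0] at h1 h2
    exact le_antisymm (not_lt.1 fun h => lt_irrefl _ (h2.1 h)) (h1.2 le_rfl)

omit [IsStrictOrderedRing R] [IsStrictOrderedRing R'] in
theorem SignCompatible.exists_maximal {Γ : Subring (R × R')} (h : SignCompatible Γ) :
    ∃ Γ', Γ ≤ Γ' ∧ Maximal SignCompatible Γ' := by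
  refine zorn_le_nonempty₀ {Γ | SignCompatible Γ} (fun c hc hchain Γ₀ hΓ₀ => ?_) Γ h
  refine ⟨sSup c, fun p hp => ?_, fun Δ hΔ => le_sSup hΔ⟩
  obtain ⟨Δ, hΔ, hpΔ⟩ := (Subring.mem_sSup_of_directedOn ⟨Γ₀, hΓ₀⟩ hchain.directedOn).1 hp
  exact hc hΔ p hpΔ

omit [IsStrictOrderedRing R] [IsStrictOrderedRing R'] in
theorem SignCompatible.mem_of_maximal {Γ : Subring (R × R')} (hΓ : Maximal SignCompatible Γ)
    (x : R) (x' : R')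
    (hx : ∀ h : Γ[X], 0 ≤ h.eval₂ ((RingHom.fst R R').comp Γ.subtype) x ↔
      0 ≤ h.eval₂ ((RingHom.snd R R').comp Γ.subtype) x') : (x, x') ∈ Γ := by
  let Δ : Subring (R × R') := (eval₂RingHom Γ.subtype (x, x')).range
  have hle : Γ ≤ Δ := fun p hp => ⟨C ⟨p, hp⟩, by simp⟩
  have hΔ : SignCompatible Δ := by
    rintro _ ⟨h, rfl⟩
    have h1 := hom_eval₂ h Γ.subtype (RingHom.fst R R') (x, x')
    have h2 := hom_eval₂ h Γ.subtype (RingHom.snd R R') (x, x')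
    simp only [RingHom.coe_fst, RingHom.coe_snd] at h1 h2
    rw [coe_eval₂RingHom, h1, h2]
    exact hx h
  exact hΓ.2 hΔ hle ⟨X, by simp⟩

theorem eval₂_inv_nonneg_iff {A : Type*} [CommRing A] (h : A[X]) (φ : A →+* R) {c : R}
    (hc : c ≠ 0) : 0 ≤ h.eval₂ φ c⁻¹ ↔ 0 ≤ h.reverse.eval₂ φ c * c ^ h.natDegree := by
  let : Invertible c⁻¹ := ⟨c, mul_inv_cancel₀ hc, inv_mul_cancel₀ hc⟩
  have h1 : h.reverse.eval₂ φ c * (c⁻¹) ^ h.natDegree = h.eval₂ φ c⁻¹ :=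
    eval₂_reverse_mul_pow φ c⁻¹ h
  have h2 : h.reverse.eval₂ φ c * c ^ h.natDegree =
      h.reverse.eval₂ φ c * (c⁻¹) ^ h.natDegree * (c ^ h.natDegree) ^ 2 := by
    rw [inv_pow, mul_assoc, sq, ← mul_assoc (c ^ h.natDegree)⁻¹,
      inv_mul_cancel₀ (pow_ne_zero _ hc), one_mul]
  rw [← h1, h2]
  exact (mul_nonneg_iff_of_pos_right (sq_pos_of_ne_zero (pow_ne_zero _ hc))).symm

theorem SignCompatible.exists_inv_of_maximal {Γ : Subring (R × R')}
    (hΓ : Maximal SignCompatible Γ) {p : R × R'} (hp : p ∈ Γ) (h0 : p.1 ≠ 0) :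
    (p.1⁻¹, p.2⁻¹) ∈ Γ := by
  have h0' : p.2 ≠ 0 := (hΓ.1.fst_eq_zero_iff hp).not.1 h0
  refine mem_of_maximal hΓ _ _ fun h => ?_
  rw [eval₂_inv_nonneg_iff _ _ h0, eval₂_inv_nonneg_iff _ _ h0']
  let q : R × R' := h.reverse.eval₂ Γ.subtype p * p ^ h.natDegree
  have hq : q ∈ Γ := by
    have : q = ((h.reverse.eval ⟨p, hp⟩ * ⟨p, hp⟩ ^ h.natDegree : Γ) : R × R') := by
      simp only [q, Subring.coe_mul, Subring.coe_pow]
      rw [← Subring.subtype_apply (h.reverse.eval _), ← eval₂_at_apply]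
      rfl
    rw [this]
    exact Subtype.property _
  have h1 := hom_eval₂ h.reverse Γ.subtype (RingHom.fst R R') p
  have h2 := hom_eval₂ h.reverse Γ.subtype (RingHom.snd R R') p
  simp only [RingHom.coe_fst, RingHom.coe_snd] at h1 h2
  rw [← h1, ← h2]
  exact hΓ.1 q hq

theorem exists_order_of_ringHom {k : Type*} [Field k] (φ : k →+* R) :
    ∃ (_ : LinearOrder k) (_ : IsStrictOrderedRing k), StrictMono φ := by
  let ord : LinearOrder k := LinearOrder.lift' φ φ.injective
  have hmono : StrictMono φ := Monotone.strictMono_of_injective (fun _ _ h => h) φ.injective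
  exact ⟨ord, Function.Injective.isStrictOrderedRing φ (map_zero φ) (map_one φ) (map_add φ)
    (map_mul φ) Iff.rfl hmono.lt_iff_lt, hmono⟩

/-- A maximal sign compatible subring is an ordered field embedded in both components. -/
theorem SignCompatible.exists_field_of_maximal {R : Type u} [Field R] [LinearOrder R]
    [IsStrictOrderedRing R] {R' : Type v} [Field R'] [LinearOrder R'] [IsStrictOrderedRing R']
    {Γ : Subring (R × R')} (hΓ : Maximal SignCompatible Γ) :
    ∃ (k : Type (max u v)) (_ : Field k) (_ : LinearOrder k) (_ : IsStrictOrderedRing k)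
      (φ : k →+* R) (ψ : k →+* R'), StrictMono φ ∧ StrictMono ψ ∧ (∀ c, (φ c, ψ c) ∈ Γ) ∧
      (∀ p ∈ Γ, ∃ c, φ c = p.1 ∧ ψ c = p.2) ∧
      ∀ x x', (∀ h : k[X], 0 ≤ h.eval₂ φ x ↔ 0 ≤ h.eval₂ ψ x') → (x, x') ∈ Γ := by
  have hF : IsField Γ :=
    { exists_pair_ne := ⟨0, 1, zero_ne_one⟩
      mul_comm := mul_comm
      mul_inv_cancel := by
        rintro ⟨p, hp⟩ h0
        have h1 : p.1 ≠ 0 := fun h => h0 <| Subtype.ext <|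
          Prod.ext h ((hΓ.1.fst_eq_zero_iff hp).1 h)
        have h2 : p.2 ≠ 0 := (hΓ.1.fst_eq_zero_iff hp).not.1 h1
        exact ⟨⟨_, exists_inv_of_maximal hΓ hp h1⟩,
          Subtype.ext (Prod.ext (mul_inv_cancel₀ h1) (mul_inv_cancel₀ h2))⟩ }
  let φ : Γ →+* R := (RingHom.fst R R').comp Γ.subtype
  let ψ : Γ →+* R' := (RingHom.snd R R').comp Γ.subtype
  let fld : Field Γ := hF.toField
  obtain ⟨ord, hord, hmono⟩ := exists_order_of_ringHom φ
  refine ⟨Γ, fld, ord, hord, φ, ψ, hmono, fun a b hab => ?_, fun c => c.2,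
    fun p hp => ⟨⟨p, hp⟩, rfl, rfl⟩, fun x x' hx => mem_of_maximal hΓ x x' hx⟩
  have h1 : φ a < φ b := hmono hab
  have h2 := (hΓ.1.pos_iff (sub_mem b.2 a.2)).1 (sub_pos.2 h1)
  exact sub_pos.1 h2

end SignCompatible

section Transfer

variable {k : Type*} [Field k] [LinearOrder k] [IsStrictOrderedRing k]
  {R' : Type*} [Field R'] [LinearOrder R'] [IsStrictOrderedRing R']
  {R : Type*} [Field R] [LinearOrder R] [IsStrictOrderedRing R]

/-- A version of `PolyIVT.exists_derivative_eq_zero` with the signs given by a product. -/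
theorem PolyIVT.exists_derivative_eq_zero_of_mul_pos (hR : PolyIVT R) (f : R[X]) {a r b : R}
    (har : a < r) (hrb : r < b) (hab : 0 < f.eval a * f.eval b) (hr : f.eval r = 0) :
    ∃ c, a < c ∧ c < b ∧ f.derivative.eval c = 0 := by
  rcases pos_and_pos_or_neg_and_neg_of_mul_pos hab with ⟨ha, hb⟩ | ⟨ha, hb⟩
  · exact hR.exists_derivative_eq_zero f har hrb ha hb hr
  · obtain ⟨c, hc1, hc2, hc⟩ := hR.exists_derivative_eq_zero (-f) har hrb (by simpa using ha)
      (by simpa using hb) (by simpa using hr)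
    exact ⟨c, hc1, hc2, by simpa using hc⟩

/-- If `f` has no critical points in `k` between `a` and `b`, then it changes sign between any two
points of `k ∩ [a, b]` separated by a root of `f` in an ordered extension of `k`. -/
theorem mul_neg_of_root_between (χ : k →+* R) (hχ : StrictMono χ) (hR : PolyIVT R) (f : k[X])
    (hk : ∀ h : k[X], h.natDegree < f.natDegree → ∀ a b, a < b → h.eval a < 0 → 0 < h.eval b →
      ∃ c, h.eval c = 0)
    (hf : ∀ c, f.eval c ≠ 0) {a b : k} (hcrit : ∀ c, a < c → c < b → f.derivative.eval c ≠ 0)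
    {y : R} {c d : k} (hac : a ≤ c) (hdb : d ≤ b) (hcy : χ c < y) (hyd : y < χ d)
    (hy : (f.map χ).eval y = 0) : f.eval c * f.eval d < 0 := by
  have hdeg : f.natDegree ≠ 0 := by
    intro hdeg
    rw [eq_C_of_natDegree_eq_zero hdeg] at hy hf
    rw [map_C, eval_C, map_eq_zero] at hy
    exact hf 0 (by rw [eval_C, hy])
  have hder0 : f.derivative ≠ 0 := fun hz => hdeg (derivative_eq_zero.1 hz)
  by_contra! hpos
  have hpos := lt_of_le_of_ne hpos (mul_ne_zero (hf c) (hf d)).symm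
  have hpos' : 0 < (f.map χ).eval (χ c) * (f.map χ).eval (χ d) := by
    rw [eval_map_apply, eval_map_apply, ← map_mul, ← map_zero χ]
    exact hχ hpos
  obtain ⟨e, he1, he2, he⟩ := hR.exists_derivative_eq_zero_of_mul_pos _ hcy hyd hpos' hy
  rw [derivative_map] at he
  obtain ⟨e, he0, rfl⟩ := exists_root_of_map_root χ hχ hR hk _ hder0
    (natDegree_derivative_lt hdeg) e he
  exact hcrit e (hac.trans_lt (hχ.lt_iff_lt.1 he1)) ((hχ.lt_iff_lt.1 he2).trans_le hdb) he0

/-- A root `x` of `f` in an ordered extension of `k` corresponds to a root in every other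
extension realizing the same cut of `k`, when `f` has no roots in `k` and `k` has the intermediate
value property in degrees less than the degree of `f`. -/
theorem exists_root_same_cut (φ : k →+* R) (hφ : StrictMono φ) (hR : PolyIVT R)
    (ψ : k →+* R') (hψ : StrictMono ψ) (hR' : PolyIVT R') (f : k[X])
    (hk : ∀ h : k[X], h.natDegree < f.natDegree → ∀ a b, a < b → h.eval a < 0 → 0 < h.eval b →
      ∃ c, h.eval c = 0)
    (hf : ∀ c, f.eval c ≠ 0) {x : R} (hx : (f.map φ).eval x = 0) {a b : k} (hax : φ a < x)
    (hxb : x < φ b) :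
    ∃ x' : R', (f.map ψ).eval x' = 0 ∧ (∀ c, φ c < x → ψ c < x') ∧ ∀ c, x < φ c → x' < ψ c := by
  have hdeg : f.natDegree ≠ 0 := by
    intro hdeg
    rw [eq_C_of_natDegree_eq_zero hdeg] at hx hf
    rw [map_C, eval_C, map_eq_zero] at hx
    exact hf 0 (by rw [eval_C, hx])
  have hder0 : f.derivative ≠ 0 := fun hz => hdeg (derivative_eq_zero.1 hz)
  let L := insert a (f.derivative.roots.toFinset.filter fun c => φ c < x)
  let U := insert b (f.derivative.roots.toFinset.filter fun c => x < φ c)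
  have hL : L.Nonempty := Finset.insert_nonempty _ _
  have hU : U.Nonempty := Finset.insert_nonempty _ _
  set a₀ := L.max' hL with ha₀
  set b₀ := U.min' hU with hb₀
  have hax₀ : φ a₀ < x := by
    rcases Finset.mem_insert.1 (L.max'_mem hL) with h | h
    · rw [ha₀, h]; exact hax
    · exact (Finset.mem_filter.1 h).2
  have hxb₀ : x < φ b₀ := by
    rcases Finset.mem_insert.1 (U.min'_mem hU) with h | h
    · rw [hb₀, h]; exact hxb
    · exact (Finset.mem_filter.1 h).2
  have hne : ∀ c, φ c ≠ x := by
    rintro c rfl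
    rw [eval_map_apply, map_eq_zero] at hx
    exact hf c hx
  have hcrit : ∀ c, a₀ < c → c < b₀ → f.derivative.eval c ≠ 0 := by
    intro c h1 h2 h0
    have hmem : c ∈ f.derivative.roots.toFinset := by simpa [hder0] using h0
    rcases lt_or_gt_of_ne (hne c) with h | h
    · exact absurd (L.le_max' c (Finset.mem_insert_of_mem (Finset.mem_filter.2 ⟨hmem, h⟩)))
        (not_le.2 h1)
    · exact absurd (U.min'_le c (Finset.mem_insert_of_mem (Finset.mem_filter.2 ⟨hmem, h⟩)))
        (not_le.2 h2)
  have h1 : f.eval a₀ * f.eval b₀ < 0 :=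
    mul_neg_of_root_between φ hφ hR f hk hf hcrit le_rfl le_rfl hax₀ hxb₀ hx
  have hab₀ : a₀ < b₀ := hφ.lt_iff_lt.1 (hax₀.trans hxb₀)
  have h2 : (f.map ψ).eval (ψ a₀) * (f.map ψ).eval (ψ b₀) < 0 := by
    rw [eval_map_apply, eval_map_apply, ← map_mul, ← map_zero ψ]
    exact hψ h1
  obtain ⟨x', hx', hax', hxb'⟩ := hR'.exists_root_between _ h2
  rw [min_eq_left (hψ hab₀).le] at hax'
  rw [max_eq_right (hψ hab₀).le] at hxb'
  have hne' : ∀ c, ψ c ≠ x' := by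
    rintro c rfl
    rw [eval_map_apply, map_eq_zero] at hx'
    exact hf c hx'
  have hfalse : ∀ c, f.eval a₀ * f.eval c < 0 → f.eval c * f.eval b₀ < 0 → False := by
    intro c h3 h4
    have h5 := mul_neg_of_neg_of_pos h1 (mul_pos_of_neg_of_neg h3 h4)
    have h6 : 0 ≤ (f.eval a₀ * f.eval b₀ * f.eval c) ^ 2 := sq_nonneg _
    linarith
  refine ⟨x', hx', fun c hc => ?_, fun c hc => ?_⟩
  · rcases le_or_gt c a₀ with h | h
    · exact (hψ.monotone h).trans_lt hax'
    · by_contra! hle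
      exact hfalse c (mul_neg_of_root_between ψ hψ hR' f hk hf hcrit le_rfl
        (hφ.lt_iff_lt.1 (hc.trans hxb₀)).le hax' (lt_of_le_of_ne hle (hne' c).symm) hx')
        (mul_neg_of_root_between φ hφ hR f hk hf hcrit h.le le_rfl hc hxb₀ hx)
  · rcases le_or_gt b₀ c with h | h
    · exact hxb'.trans_le (hψ.monotone h)
    · by_contra! hle
      exact hfalse c (mul_neg_of_root_between φ hφ hR f hk hf hcrit le_rfl h.le hax₀ hc hx)
        (mul_neg_of_root_between ψ hψ hR' f hk hf hcrit (hφ.lt_iff_lt.1 (hax₀.trans hc)).le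
        le_rfl (lt_of_le_of_ne hle (hne' c)) hxb' hx')

end Transfer

theorem eval₂_eq_eval_map_mod {k S : Type*} [Field k] [CommRing S] (χ : k →+* S) {f : k[X]} {y : S}
    (hy : (f.map χ).eval y = 0) (h : k[X]) : h.eval₂ χ y = ((h % f).map χ).eval y := by
  conv_lhs => rw [← EuclideanDomain.div_add_mod h f]
  rw [eval₂_add, eval₂_mul, ← eval_map, hy, zero_mul, zero_add, eval_map]

section Transfer

variable {k : Type*} [Field k] [LinearOrder k] [IsStrictOrderedRing k]
  {R : Type*} [Field R] [LinearOrder R] [IsStrictOrderedRing R]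
  {R' : Type*} [Field R'] [LinearOrder R'] [IsStrictOrderedRing R']

theorem eval_nonneg_iff_of_same_cut (φ : k →+* R) (hφ : StrictMono φ) (hR : PolyIVT R)
    (ψ : k →+* R') (hψ : StrictMono ψ) (hR' : PolyIVT R') {D : ℕ}
    (hk : ∀ f : k[X], f.natDegree < D → ∀ a b, a < b → f.eval a < 0 → 0 < f.eval b →
      ∃ c, f.eval c = 0)
    {x : R} {x' : R'} (hx : ∀ c, φ c ≠ x) (hlt : ∀ c, φ c < x → ψ c < x')
    (hgt : ∀ c, x < φ c → x' < ψ c) (h : k[X]) (hD : h.natDegree < D) :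
    0 ≤ (h.map φ).eval x ↔ 0 ≤ (h.map ψ).eval x' := by
  by_cases h0 : h = 0
  · simp [h0]
  rcases lt_trichotomy 0 ((h.map φ).eval x) with h1 | h1 | h1
  · exact iff_of_true h1.le
      (eval_pos_of_same_cut φ hφ hR ψ hψ hR' hk hx hlt hgt h hD h1).le
  · obtain ⟨c, -, hc⟩ := exists_root_of_map_root φ hφ hR hk h h0 hD x h1.symm
    exact absurd hc (hx c)
  · have h2 := eval_pos_of_same_cut φ hφ hR ψ hψ hR' hk hx hlt hgt (-h) (by simpa using hD)
      (by simpa using h1)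
    refine iff_of_false (not_le.2 h1) (not_le.2 ?_)
    simpa using h2

theorem exists_root_of_maximal (φ : k →+* R) (hφ : StrictMono φ) (hR : PolyIVT R)
    (ψ : k →+* R') (hψ : StrictMono ψ) (hR' : PolyIVT R')
    (hmax : ∀ x x', (∀ h : k[X], 0 ≤ h.eval₂ φ x ↔ 0 ≤ h.eval₂ ψ x') → ∃ c, φ c = x)
    (f : k[X]) (a b : k) (hab : a < b) (ha : f.eval a < 0) (hb : 0 < f.eval b) :
    ∃ c, f.eval c = 0 := by
  induction hd : f.natDegree using Nat.strong_induction_on generalizing f a b with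
  | _ d ih =>
  by_contra! hf
  have hk : ∀ h : k[X], h.natDegree < f.natDegree → ∀ a b, a < b → h.eval a < 0 → 0 < h.eval b →
      ∃ c, h.eval c = 0 := fun h hh a b h1 h2 h3 => ih _ (hd ▸ hh) h a b h1 h2 h3 rfl
  obtain ⟨x, hax, hxb, hx⟩ := hR (f.map φ) (φ a) (φ b) (hφ hab)
    (by rw [eval_map_apply, ← map_zero φ]; exact hφ ha)
    (by rw [eval_map_apply, ← map_zero φ]; exact hφ hb)
  have hne : ∀ c, φ c ≠ x := by
    rintro c rfl
    rw [eval_map_apply, map_eq_zero] at hx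
    exact hf c hx
  obtain ⟨x', hx', hlt, hgt⟩ := exists_root_same_cut φ hφ hR ψ hψ hR' f hk hf hx hax hxb
  have hdeg : f.natDegree ≠ 0 := by
    intro hdeg
    rw [eq_C_of_natDegree_eq_zero hdeg] at hx hf
    rw [map_C, eval_C, map_eq_zero] at hx
    exact hf 0 (by rw [eval_C, hx])
  obtain ⟨c, hc⟩ := hmax x x' fun h => by
    rw [eval₂_eq_eval_map_mod φ hx, eval₂_eq_eval_map_mod ψ hx']
    exact eval_nonneg_iff_of_same_cut φ hφ hR ψ hψ hR' hk hne hlt hgt (h % f)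
      (natDegree_mod_lt h hdeg)
  exact hne c hc

end Transfer

/-- A finite set of elements of an ordered field `R` with the intermediate value property can be
adjoined to a field isomorphism between ordered fields extending the identity of `ℝ`. -/
theorem exists_signCompatible {R : Type} [Field R] [LinearOrder R] [IsStrictOrderedRing R]
    (hR : PolyIVT R) (ι : ℝ →+* R) (s : Finset R) :
    ∃ (R' : Type) (_ : Field R') (_ : LinearOrder R') (_ : IsStrictOrderedRing R')
      (ι' : ℝ →+* R') (Γ : Subring (R × R')), PolyIVT R' ∧ Realizes ι' ∧ SignCompatible Γ ∧
      (∀ r, (ι r, ι' r) ∈ Γ) ∧ ∀ x ∈ s, ∃ x', (x, x') ∈ Γ := by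
  classical
  induction s using Finset.induction_on with
  | empty =>
    refine ⟨ℝ, inferInstance, inferInstance, inferInstance, RingHom.id ℝ,
      (ι.prod (RingHom.id ℝ)).range, polyIVT_real, realizes_id, ?_, fun r => ⟨r, rfl⟩, by simp⟩
    rintro _ ⟨r, rfl⟩
    have hmono : ∀ r, 0 ≤ r → 0 ≤ ι r := by
      intro r hr
      rw [← Real.mul_self_sqrt hr, map_mul]
      exact mul_self_nonneg _
    refine ⟨fun h => ?_, hmono r⟩
    by_contra! hneg
    have h1 := hmono (-r) (by simpa using hneg.le)
    rw [map_neg, Left.nonneg_neg_iff] at h1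
    have h2 : ι r = 0 := le_antisymm h1 h
    rw [map_eq_zero] at h2
    exact hneg.ne h2
  | insert x s _ ih =>
    obtain ⟨R', _, _, _, ι', Γ, hR', hι', hΓ, hιΓ, hs⟩ := ih
    obtain ⟨Δ, hle, hΔ⟩ := hΓ.exists_maximal
    obtain ⟨k, _, _, _, φ, ψ, hφ, hψ, hmem, hmem', hmax⟩ :=
      SignCompatible.exists_field_of_maximal hΔ
    by_cases hx : ∃ c, φ c = x
    · obtain ⟨c, rfl⟩ := hx
      refine ⟨R', _, _, ‹_›, ι', Δ, hR', hι', hΔ.1, fun r => hle (hιΓ r), fun y hy => ?_⟩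
      rcases Finset.mem_insert.1 hy with rfl | hy
      · exact ⟨_, hmem c⟩
      · exact (hs y hy).imp fun _ h => hle h
    push Not at hx
    have hk := exists_root_of_maximal φ hφ hR ψ hψ hR' fun y y' hy => by
      obtain ⟨c, hc, -⟩ := hmem' _ (hmax y y' hy)
      exact ⟨c, hc⟩
    have hm : ∀ S : Finset k, ∃ m : k, (∀ c ∈ S, φ c < x → c < m) ∧ ∀ c ∈ S, x < φ c → m < c := by
      intro S
      obtain ⟨m, hm1, hm2⟩ := Order.exists_between_finsets
        (lo := S.filter fun c => φ c < x) (hi := S.filter fun c => x < φ c) (by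
          intro a ha b hb
          exact hφ.lt_iff_lt.1 ((Finset.mem_filter.1 ha).2.trans (Finset.mem_filter.1 hb).2))
      exact ⟨m, fun c hc h => hm1 c (Finset.mem_filter.2 ⟨hc, h⟩),
        fun c hc h => hm2 c (Finset.mem_filter.2 ⟨hc, h⟩)⟩
    choose m hm1 hm2 using hm
    let U : Ultrafilter (Finset k) := Ultrafilter.of Filter.atTop
    have hU : ∀ c, ∀ᶠ S in (U : Filter (Finset k)), c ∈ S := fun c =>
      Ultrafilter.of_le _ ((Filter.eventually_ge_atTop {c}).mono fun S hS =>
        hS (Finset.mem_singleton_self c))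
    let x' : Filter.Germ (U : Filter (Finset k)) R' := ((fun S => ψ (m S) : Finset k → R') : _)
    let χ := (ultrapowerDiag U R').comp ψ
    have hχ : StrictMono χ := fun a b hab => Filter.Germ.const_lt (hψ hab)
    have hlt : ∀ c, φ c < x → χ c < x' := fun c hc =>
      Filter.Germ.coe_lt.2 ((hU c).mono fun S hS => hψ (hm1 S c hS hc))
    have hgt : ∀ c, x < φ c → x' < χ c := fun c hc =>
      Filter.Germ.coe_lt.2 ((hU c).mono fun S hS => hψ (hm2 S c hS hc))
    have hsub : ∀ p ∈ Γ, ((p.1, ultrapowerDiag U R' p.2) : R × Filter.Germ (U : Filter _) R') ∈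
        (eval₂RingHom (φ.prod χ) (x, x')).range := by
      intro p hp
      obtain ⟨c, hc1, hc2⟩ := hmem' p (hle hp)
      refine ⟨C c, ?_⟩
      rw [← hc1, ← hc2, coe_eval₂RingHom, eval₂_C]
      rfl
    refine ⟨Filter.Germ (U : Filter (Finset k)) R', inferInstance, inferInstance, inferInstance,
      (ultrapowerDiag U R').comp ι', (eval₂RingHom (φ.prod χ) (x, x')).range, hR'.germ U,
      hι'.germ U, ?_, fun r => hsub _ (hιΓ r), fun y hy => ?_⟩
    · rintro _ ⟨h, rfl⟩
      have h1 := hom_eval₂ h (φ.prod χ) (RingHom.fst R _) (x, x')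
      have h2 := hom_eval₂ h (φ.prod χ) (RingHom.snd R _) (x, x')
      simp only [RingHom.coe_fst, RingHom.coe_snd, RingHom.fst_comp_prod,
        RingHom.snd_comp_prod] at h1 h2
      rw [coe_eval₂RingHom, h1, h2, ← eval_map, ← eval_map]
      exact eval_nonneg_iff_of_same_cut φ hφ hR χ hχ (hR'.germ U)
        (D := h.natDegree + 1) (fun f _ => hk f) hx hlt hgt h (Nat.lt_succ_self _)
    · rcases Finset.mem_insert.1 hy with rfl | hy
      · exact ⟨x', X, by simp⟩
      · obtain ⟨z, hz⟩ := hs y hy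
        exact ⟨_, hsub _ hz⟩

/-- A finite system of nonstrict polynomial inequalities with real coefficients which is solvable
in an ordered field with the intermediate value property is solvable in `ℝ`. -/
theorem PolyIVT.realizes {R : Type} [Field R] [LinearOrder R] [IsStrictOrderedRing R]
    (hR : PolyIVT R) (ι : ℝ →+* R) : Realizes ι := by
  classical
  intro n s v hv
  obtain ⟨R', _, _, _, ι', Γ, -, hι', hΓ, hιΓ, hvΓ⟩ :=
    exists_signCompatible hR ι (Finset.univ.image v)
  choose v' hv' using fun i => hvΓ (v i) (Finset.mem_image_of_mem v (Finset.mem_univ i))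
  have key : ∀ p, (MvPolynomial.eval₂ ι v p, MvPolynomial.eval₂ ι' v' p) ∈ Γ := by
    intro p
    induction p using MvPolynomial.induction_on with
    | C a => simpa using hιΓ a
    | add p q hp hq => simpa using add_mem hp hq
    | mul_X p i hp => simpa using mul_mem hp (hv' i)
  exact hι' n s v' fun p hp => (hΓ _ (key p)).1 (hv p hp)

/-- The Positivstellensatz: a polynomial `p` positive on the set where all `g j` are nonnegative
satisfies `s * p = 1 + t` with `s` and `t` in the preordering `T` containing all `g j`. -/
theorem exists_mul_eq_one_add {n : ℕ} {ι : Type*} [Finite ι]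
    (T : Subsemiring (MvPolynomial (Fin n) ℝ)) (hsq : ∀ a, a ^ 2 ∈ T)
    (g : ι → MvPolynomial (Fin n) ℝ) (hg : ∀ j, g j ∈ T) (p : MvPolynomial (Fin n) ℝ)
    (hp : ∀ x, (∀ j, 0 ≤ MvPolynomial.eval x (g j)) → 0 < MvPolynomial.eval x p) :
    ∃ s ∈ T, ∃ t ∈ T, s * p = 1 + t := by
  classical
  by_contra! hcon
  have := Fintype.ofFinite ι
  let T' : Subsemiring (MvPolynomial (Fin n) ℝ) :=
    { carrier := {a | ∃ s ∈ T, ∃ t ∈ T, a = t - s * p}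
      zero_mem' := ⟨0, zero_mem _, 0, zero_mem _, by ring⟩
      one_mem' := ⟨0, zero_mem _, 1, one_mem _, by ring⟩
      add_mem' := by
        rintro _ _ ⟨s, hs, t, ht, rfl⟩ ⟨s', hs', t', ht', rfl⟩
        exact ⟨s + s', add_mem hs hs', t + t', add_mem ht ht', by ring⟩
      mul_mem' := by
        rintro _ _ ⟨s, hs, t, ht, rfl⟩ ⟨s', hs', t', ht', rfl⟩
        exact ⟨t * s' + s * t', add_mem (mul_mem ht hs') (mul_mem hs ht'),
          t * t' + s * s' * p ^ 2, add_mem (mul_mem ht ht') (mul_mem (mul_mem hs hs') (hsq p)),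
          by ring⟩ }
  have hTT' : T ≤ T' := fun t ht => ⟨0, zero_mem _, t, ht, by ring⟩
  have hpT' : -p ∈ T' := ⟨1, one_mem _, 0, zero_mem _, by ring⟩
  obtain ⟨P, hTP, hP1, htot, hprime⟩ := exists_primeCone T' (fun a => hTT' (hsq a)) (by
    rintro ⟨s, hs, t, ht, h⟩
    exact hcon s hs t ht (by linear_combination h))
  obtain ⟨R, _, _, _, φ, hR, hφ⟩ := exists_ordered_field_of_primeCone P hP1 htot hprime
  have heval : ∀ q, MvPolynomial.eval₂ (φ.comp MvPolynomial.C) (fun i => φ (MvPolynomial.X i)) q =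
      φ q := by
    intro q
    refine (MvPolynomial.eval₂_comp_left φ MvPolynomial.C MvPolynomial.X q).symm.trans ?_
    rw [MvPolynomial.eval₂_eta]
  obtain ⟨w, hw⟩ := hR.realizes (φ.comp MvPolynomial.C) n (insert (-p) (Finset.univ.image g))
    (fun i => φ (MvPolynomial.X i)) (by
      intro q hq
      rw [heval]
      refine hφ q (hTP ?_)
      rcases Finset.mem_insert.1 hq with rfl | hq
      · exact hpT'
      · obtain ⟨j, -, rfl⟩ := Finset.mem_image.1 hq
        exact hTT' (hg j))
  have h1 := hp w fun j => hw (g j)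
    (Finset.mem_insert_of_mem (Finset.mem_image_of_mem g (Finset.mem_univ j)))
  have h2 := hw (-p) (Finset.mem_insert_self _ _)
  rw [map_neg] at h2
  linarith

section Archimedean

variable {n : ℕ} {T : Subsemiring (MvPolynomial (Fin n) ℝ)}

theorem C_mem_of_nonneg (hsq : ∀ a, a ^ 2 ∈ T) {r : ℝ} (hr : 0 ≤ r) : MvPolynomial.C r ∈ T := by
  have h := hsq (MvPolynomial.C (√r))
  rwa [← map_pow, Real.sq_sqrt hr] at h

/-- A preordering `T` is archimedean if the sum of the squares of the variables is bounded. -/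
theorem exists_bound_of_sum_sq (hsq : ∀ a, a ^ 2 ∈ T) {N : ℝ}
    (hN : MvPolynomial.C N - ∑ i, MvPolynomial.X i ^ 2 ∈ T) (p : MvPolynomial (Fin n) ℝ) :
    ∃ M : ℝ, 0 < M ∧ MvPolynomial.C M - p ∈ T ∧ MvPolynomial.C M + p ∈ T := by
  suffices h : ∃ M : ℝ, MvPolynomial.C M - p ∈ T ∧ MvPolynomial.C M + p ∈ T by
    obtain ⟨M, h1, h2⟩ := h
    have h3 := C_mem_of_nonneg hsq (neg_le_iff_add_nonneg.1 (neg_abs_le M))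
    have h4 : (1 : MvPolynomial (Fin n) ℝ) ∈ T := one_mem T
    refine ⟨|M| + 1, by positivity, ?_, ?_⟩
    · have : MvPolynomial.C (|M| + 1) - p
          = MvPolynomial.C M - p + MvPolynomial.C (|M| - M) + 1 := by
        simp only [map_add, map_sub, map_one]; ring
      rw [this]
      exact add_mem (add_mem h1 (C_mem_of_nonneg hsq (sub_nonneg.2 (le_abs_self M)))) h4
    · have : MvPolynomial.C (|M| + 1) + p
          = MvPolynomial.C M + p + MvPolynomial.C (|M| - M) + 1 := by
        simp only [map_add, map_sub, map_one]; ring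
      rw [this]
      exact add_mem (add_mem h2 (C_mem_of_nonneg hsq (sub_nonneg.2 (le_abs_self M)))) h4
  have half : MvPolynomial.C (1 / 2) ∈ T := C_mem_of_nonneg hsq (by norm_num)
  have half2 : (MvPolynomial.C (1 / 2 : ℝ) * 2 : MvPolynomial (Fin n) ℝ) = 1 := by
    rw [← map_ofNat MvPolynomial.C 2, ← map_mul]; norm_num
  induction p using MvPolynomial.induction_on with
  | C a =>
    refine ⟨|a|, ?_, ?_⟩
    · rw [← map_sub]
      exact C_mem_of_nonneg hsq (sub_nonneg.2 (le_abs_self a))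
    · rw [← map_add]
      exact C_mem_of_nonneg hsq (by linarith [neg_abs_le a])
  | add p q hp hq =>
    obtain ⟨M, hp1, hp2⟩ := hp
    obtain ⟨M', hq1, hq2⟩ := hq
    refine ⟨M + M', ?_, ?_⟩
    · convert add_mem hp1 hq1 using 1
      rw [map_add]; ring
    · convert add_mem hp2 hq2 using 1
      rw [map_add]; ring
  | mul_X p i hp =>
    obtain ⟨M, hp1, hp2⟩ := hp
    have hX : MvPolynomial.C N - MvPolynomial.X i ^ 2 ∈ T := by
      convert add_mem hN (sum_mem fun j (_ : j ∈ Finset.univ.erase i) => hsq (MvPolynomial.X j))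
        using 1
      rw [← Finset.add_sum_erase _ _ (Finset.mem_univ i)]
      ring
    obtain ⟨M', hq1, hq2⟩ : ∃ M' : ℝ,
        MvPolynomial.C M' - MvPolynomial.X i ∈ T ∧ MvPolynomial.C M' + MvPolynomial.X i ∈ T := by
      refine ⟨1 / 2 * (N + 1), ?_, ?_⟩
      · convert mul_mem half (add_mem hX (hsq (MvPolynomial.X i - 1))) using 1
        simp only [map_mul, map_add, map_one]
        linear_combination (MvPolynomial.X i) * half2
      · convert mul_mem half (add_mem hX (hsq (MvPolynomial.X i + 1))) using 1
        simp only [map_mul, map_add, map_one]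
        linear_combination (-MvPolynomial.X i) * half2
    refine ⟨M * M', ?_, ?_⟩
    · convert mul_mem half (add_mem (mul_mem hp1 hq2) (mul_mem hp2 hq1)) using 1
      rw [map_mul]
      linear_combination (p * MvPolynomial.X i - MvPolynomial.C M * MvPolynomial.C M') * half2
    · convert mul_mem half (add_mem (mul_mem hp1 hq1) (mul_mem hp2 hq2)) using 1
      rw [map_mul]
      linear_combination (-p * MvPolynomial.X i - MvPolynomial.C M * MvPolynomial.C M') * half2

/-- If `s (N - ∑ Xᵢ²) = 1 + t` with `s` and `t` in the preordering `T`, then `T` bounds `∑ Xᵢ²`. -/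
theorem exists_sub_sum_sq_mem (hsq : ∀ a, a ^ 2 ∈ T) {s t : MvPolynomial (Fin n) ℝ} {N : ℝ}
    (hN0 : 0 ≤ N) (hs : s ∈ T) (ht : t ∈ T)
    (hst : s * (MvPolynomial.C N - ∑ i, MvPolynomial.X i ^ 2) = 1 + t) :
    ∃ M : ℝ, MvPolynomial.C M - ∑ i, MvPolynomial.X i ^ 2 ∈ T := by
  set q : MvPolynomial (Fin n) ℝ := ∑ i, MvPolynomial.X i ^ 2 with hq
  have hqT : q ∈ T := sum_mem fun i _ => hsq _
  set p := MvPolynomial.C N - q with hp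
  let T₀ : Subsemiring (MvPolynomial (Fin n) ℝ) :=
    { carrier := {a | ∃ σ ∈ T, ∃ τ ∈ T, a = σ + p * τ}
      zero_mem' := ⟨0, zero_mem _, 0, zero_mem _, by ring⟩
      one_mem' := ⟨1, one_mem _, 0, zero_mem _, by ring⟩
      add_mem' := by
        rintro _ _ ⟨s, hs, t, ht, rfl⟩ ⟨s', hs', t', ht', rfl⟩
        exact ⟨s + s', add_mem hs hs', t + t', add_mem ht ht', by ring⟩
      mul_mem' := by
        rintro _ _ ⟨s, hs, t, ht, rfl⟩ ⟨s', hs', t', ht', rfl⟩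
        exact ⟨s * s' + t * t' * p ^ 2, add_mem (mul_mem hs hs') (mul_mem (mul_mem ht ht') (hsq p)),
          t * s' + s * t', add_mem (mul_mem ht hs') (mul_mem hs ht'), by ring⟩ }
  obtain ⟨M, hM, ⟨σ, hσ, τ, hτ, hMt⟩, -⟩ := exists_bound_of_sum_sq (T := T₀) (N := N)
    (fun a => ⟨a ^ 2, hsq a, 0, zero_mem _, by ring⟩)
    ⟨0, zero_mem _, 1, one_mem _, by rw [hp]; ring⟩ t
  have h1 : (1 + t) * (MvPolynomial.C M - t) ∈ T := by
    have : (1 + t) * (MvPolynomial.C M - t) = (1 + t) * σ + s * τ * p ^ 2 := by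
      linear_combination (1 + t) * hMt - τ * p * hst
    rw [this]
    exact add_mem (mul_mem (add_mem (one_mem _) ht) hσ) (mul_mem (mul_mem hs hτ) (hsq p))
  have half2 : (MvPolynomial.C (M / 2) * 2 : MvPolynomial (Fin n) ℝ) = MvPolynomial.C M := by
    rw [← map_ofNat MvPolynomial.C 2, ← map_mul]; norm_num
  have h2 : MvPolynomial.C M + MvPolynomial.C (M / 2) ^ 2 - t ∈ T := by
    convert add_mem h1 (hsq (MvPolynomial.C (M / 2) - t)) using 1
    linear_combination t * half2
  refine ⟨N + N * (M + (M / 2) ^ 2), ?_⟩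
  have h3 : MvPolynomial.C N * (MvPolynomial.C M + MvPolynomial.C (M / 2) ^ 2 - t)
      + s * p ^ 2 + t * q ∈ T :=
    add_mem (add_mem (mul_mem (C_mem_of_nonneg hsq hN0) h2) (mul_mem hs (hsq p))) (mul_mem ht hqT)
  convert h3 using 1
  simp only [map_add, map_mul, map_pow]
  linear_combination (-p) * hst + (1 + t) * hp

/-- **Schmüdgen's Positivstellensatz**: if the set `K` where all `g j` are nonnegative is compact,
then a polynomial positive on `K` lies in every preordering containing all `g j`. -/
theorem mem_of_pos_on_compact {ι : Type*} [Finite ι] (hsq : ∀ a, a ^ 2 ∈ T)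
    (g : ι → MvPolynomial (Fin n) ℝ) (hg : ∀ j, g j ∈ T)
    (hK : IsCompact {x : Fin n → ℝ | ∀ j, 0 ≤ MvPolynomial.eval x (g j)})
    (p : MvPolynomial (Fin n) ℝ)
    (hp : ∀ x, (∀ j, 0 ≤ MvPolynomial.eval x (g j)) → 0 < MvPolynomial.eval x p) : p ∈ T := by
  obtain ⟨M, hM⟩ : ∃ M : ℝ, MvPolynomial.C M - ∑ i, MvPolynomial.X i ^ 2 ∈ T := by
    obtain ⟨B, hB⟩ := hK.bddAbove_image (f := fun x : Fin n → ℝ => ∑ i, x i ^ 2)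
      (by fun_prop)
    obtain ⟨s, hs, t, ht, hst⟩ := exists_mul_eq_one_add T hsq g hg
      (MvPolynomial.C (|B| + 1) - ∑ i, MvPolynomial.X i ^ 2) (by
        intro x hx
        have h1 : ∑ i, x i ^ 2 ≤ B := hB ⟨x, hx, rfl⟩
        have h2 := le_abs_self B
        simp only [map_sub, MvPolynomial.eval_C, map_sum, map_pow, MvPolynomial.eval_X]
        linarith)
    exact exists_sub_sum_sq_mem hsq (by positivity) hs ht hst
  obtain ⟨s, hs, t, ht, hst⟩ := exists_mul_eq_one_add T hsq g hg p hp
  obtain ⟨N, hN, hNs, -⟩ := exists_bound_of_sum_sq hsq hM s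
  obtain ⟨r₀, hr₀, -, hpr⟩ := exists_bound_of_sum_sq hsq hM p
  have step : ∀ r : ℝ, 0 ≤ r → p + MvPolynomial.C r ∈ T → p + MvPolynomial.C (r - 1 / N) ∈ T := by
    intro r hr h
    have h1 : (MvPolynomial.C N - s) * (p + MvPolynomial.C r) + t + MvPolynomial.C r * s ∈ T :=
      add_mem (add_mem (mul_mem hNs h) ht) (mul_mem (C_mem_of_nonneg hsq hr) hs)
    have h2 : (MvPolynomial.C (1 / N) * MvPolynomial.C N : MvPolynomial (Fin n) ℝ) = 1 := by
      rw [← map_mul, one_div_mul_cancel hN.ne', map_one]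
    convert mul_mem (C_mem_of_nonneg hsq (one_div_pos.2 hN).le) h1 using 1
    rw [map_sub]
    linear_combination (-p - MvPolynomial.C r) * h2 + MvPolynomial.C (1 / N) * hst
  have hneg : ∀ r : ℝ, r ≤ 0 → p + MvPolynomial.C r ∈ T → p ∈ T := by
    intro r hr h
    convert add_mem h (C_mem_of_nonneg hsq (neg_nonneg.2 hr)) using 1
    rw [map_neg]; ring
  have hiter : ∀ k : ℕ, p ∈ T ∨ p + MvPolynomial.C (r₀ - k * (1 / N)) ∈ T := by
    intro k
    induction k with
    | zero => right; simpa [add_comm] using hpr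
    | succ k ih =>
      rcases ih with ih | ih
      · exact Or.inl ih
      rcases le_total (r₀ - k * (1 / N)) 0 with h | h
      · exact Or.inl (hneg _ h ih)
      · right
        convert step _ h ih using 3
        push_cast; ring
  obtain ⟨k, hk⟩ := exists_nat_ge (r₀ * N)
  rcases hiter k with h | h
  · exact h
  · refine hneg _ ?_ h
    rw [mul_one_div, sub_nonpos, le_div_iff₀ hN]
    exact hk

end Archimedean

/-- A real polynomial nonnegative on the real line is a sum of two squares. -/
theorem Polynomial.exists_sq_add_sq_of_nonneg (p : ℝ[X]) (hp : ∀ t, 0 ≤ p.eval t) :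
    ∃ a b : ℝ[X], p = a ^ 2 + b ^ 2 := by
  induction hd : p.natDegree using Nat.strong_induction_on generalizing p with
  | h d ih =>
    rcases Nat.eq_zero_or_pos d with rfl | hpos
    · rw [eq_C_of_natDegree_eq_zero hd] at hp ⊢
      refine ⟨C (√(p.coeff 0)), 0, ?_⟩
      rw [← C_pow, Real.sq_sqrt (by simpa using hp 0)]
      simp
    have hp0 : p ≠ 0 := by
      rintro rfl
      simp at hd
      omega
    have reduce : ∀ u q : ℝ[X], p = u * q → 0 < u.natDegree → (∀ t, 0 ≤ q.eval t) →
        ∃ a b : ℝ[X], q = a ^ 2 + b ^ 2 := by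
      intro u q hpu hu hq
      have hq0 : q ≠ 0 := by rintro rfl; simp [hp0] at hpu
      have hu0 : u ≠ 0 := by rintro rfl; simp [hp0] at hpu
      have := natDegree_mul hu0 hq0
      rw [← hpu, hd] at this
      exact ih _ (by omega) q hq rfl
    obtain ⟨w, hw⟩ : ∃ w : ℂ, aeval w p = 0 :=
      IsAlgClosed.exists_aeval_eq_zero ℂ p (natDegree_pos_iff_degree_pos.1 (hd ▸ hpos)).ne'
    by_cases him : w.im = 0
    · set r := w.re
      have hr : p.IsRoot r := by
        have hwr : w = algebraMap ℝ ℂ r := Complex.ext (by simp [r]) (by simp [him])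
        rw [hwr, aeval_algebraMap_apply, coe_aeval_eq_eval] at hw
        simpa using hw
      obtain ⟨q, hq⟩ := dvd_iff_isRoot.2 hr
      have hqr : q.IsRoot r := by
        have hev : ∀ t, 0 ≤ (t - r) * q.eval t := fun t => by
          have := hp t
          rw [hq] at this
          simpa using this
        have hc : ContinuousAt (fun t => q.eval t) r := q.continuous.continuousAt
        refine le_antisymm ?_ ?_
        · refine le_of_tendsto (hc.tendsto.mono_left nhdsWithin_le_nhds :
            Filter.Tendsto _ (nhdsWithin r (Set.Iio r)) _) ?_
          filter_upwards [self_mem_nhdsWithin] with t ht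
          exact nonpos_of_mul_nonneg_right (hev t) (sub_neg.2 ht)
        · refine ge_of_tendsto (hc.tendsto.mono_left nhdsWithin_le_nhds :
            Filter.Tendsto _ (nhdsWithin r (Set.Ioi r)) _) ?_
          filter_upwards [self_mem_nhdsWithin] with t ht
          exact nonneg_of_mul_nonneg_right (hev t) (sub_pos.2 ht)
      obtain ⟨q', hq'⟩ := dvd_iff_isRoot.2 hqr
      have hpq : p = (X - C r) ^ 2 * q' := by rw [hq, hq']; ring
      obtain ⟨a, b, hab⟩ := reduce _ q' hpq (by simp) (by
        have hne : ∀ t ∈ ({r}ᶜ : Set ℝ), 0 ≤ q'.eval t := by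
          intro t ht
          have h1 := hp t
          rw [hpq, eval_mul, eval_pow, eval_sub, eval_X, eval_C] at h1
          exact nonneg_of_mul_nonneg_right h1 (sq_pos_of_ne_zero (sub_ne_zero.2 ht))
        intro t
        have hcl : IsClosed {t | 0 ≤ q'.eval t} := isClosed_le continuous_const q'.continuous
        have := hcl.closure_subset_iff.2 hne
        rw [(dense_compl_singleton r).closure_eq] at this
        exact this (Set.mem_univ t))
      exact ⟨(X - C r) * a, (X - C r) * b, by rw [hpq, hab]; ring⟩
    · obtain ⟨q, hq⟩ := quadratic_dvd_of_aeval_eq_zero_im_ne_zero p hw him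
      have hquad : (X ^ 2 - C (2 * w.re) * X + C (‖w‖ ^ 2) : ℝ[X])
          = (X - C w.re) ^ 2 + C w.im ^ 2 := by
        rw [← Complex.normSq_eq_norm_sq, Complex.normSq_apply]
        simp only [map_add, map_mul, map_ofNat]
        ring
      rw [hquad] at hq
      have hdeg : ((X - C w.re) ^ 2 + C w.im ^ 2 : ℝ[X]).natDegree = 2 := by
        rw [← C_pow, natDegree_add_C]
        simp
      obtain ⟨a, b, hab⟩ := reduce _ q hq (by rw [hdeg]; norm_num) (by
        intro t
        have h1 := hp t
        rw [hq] at h1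
        simp only [eval_mul, eval_add, eval_pow, eval_sub, eval_X, eval_C] at h1
        exact nonneg_of_mul_nonneg_right h1 (by positivity))
      refine ⟨(X - C w.re) * a - C w.im * b, (X - C w.re) * b + C w.im * a, ?_⟩
      rw [hq, hab]
      ring

section Approximation

variable {n : ℕ}

/-- **Stone-Weierstrass** for polynomials in several variables. -/
theorem MvPolynomial.exists_abs_eval_sub_lt {K : Set (Fin n → ℝ)} (hK : IsCompact K)
    {χ : (Fin n → ℝ) → ℝ} (hχ : Continuous χ) {δ : ℝ} (hδ : 0 < δ) :
    ∃ p : MvPolynomial (Fin n) ℝ, ∀ y ∈ K, |MvPolynomial.eval y p - χ y| < δ := by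
  let φ : MvPolynomial (Fin n) ℝ →ₐ[ℝ] C(Fin n → ℝ, ℝ) :=
    MvPolynomial.aeval fun i => ⟨fun x => x i, continuous_apply i⟩
  have hφ : ∀ p x, φ p x = MvPolynomial.eval x p := by
    intro p x
    induction p using MvPolynomial.induction_on with
    | C a => simp [φ]
    | add p q hp hq => simp [hp, hq]
    | mul_X p i hp => simp [hp]; simp [φ]
  have hsep : φ.range.SeparatesPoints := by
    intro x y hxy
    obtain ⟨i, hi⟩ := Function.ne_iff.1 hxy
    exact ⟨_, ⟨φ (MvPolynomial.X i), ⟨_, rfl⟩, rfl⟩, by simpa [hφ] using hi⟩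
  obtain ⟨_, ⟨p, rfl⟩, hp⟩ :=
    ContinuousMap.exists_mem_subalgebra_near_continuous_of_isCompact_of_separatesPoints
      hsep ⟨χ, hχ⟩ hK hδ
  refine ⟨p, fun y hy => ?_⟩
  simpa [hφ] using hp y hy

/-- Finitely many continuous functions are simultaneously approximated on a compact set `K` by
combinations of their values at points of `K`, with coefficients that are polynomials positive
on `K`. -/
theorem exists_pos_polynomial_interpolation {K : Set (Fin n → ℝ)} (hK : IsCompact K)
    {s : Finset ℕ} {a : ℕ → (Fin n → ℝ) → ℝ} (ha : ∀ k, Continuous (a k)) {ε : ℝ} (hε : 0 < ε) :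
    ∃ (N : ℕ) (x : Fin N → Fin n → ℝ) (p : Fin N → MvPolynomial (Fin n) ℝ),
      (∀ i, x i ∈ K) ∧ (∀ i, ∀ y ∈ K, 0 < MvPolynomial.eval y (p i)) ∧
      ∀ k ∈ s, ∀ y ∈ K, |a k y - ∑ i, MvPolynomial.eval y (p i) * a k (x i)| < ε := by
  let U : (Fin n → ℝ) → Set (Fin n → ℝ) := fun x => {y | ∀ k ∈ s, |a k y - a k x| < ε / 2}
  have hU : ∀ x, IsOpen (U x) := by
    intro x
    have : U x = ⋂ k ∈ s, {y | |a k y - a k x| < ε / 2} := by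
      ext; simp [U]
    rw [this]
    exact isOpen_biInter_finset fun k _ =>
      isOpen_lt (((ha k).sub continuous_const).abs) continuous_const
  obtain ⟨F, hFK, hF⟩ := hK.elim_nhds_subcover U fun x _ =>
    (hU x).mem_nhds fun k _ => by simpa using half_pos hε
  let x : Fin F.card → Fin n → ℝ := fun i => (F.equivFin.symm i : Fin n → ℝ)
  have hcov : K ⊆ ⋃ i, U (x i) := by
    intro y hy
    obtain ⟨w, hw, hyw⟩ := Set.mem_iUnion₂.1 (hF hy)
    exact Set.mem_iUnion.2 ⟨F.equivFin ⟨w, hw⟩, by simpa [x] using hyw⟩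
  obtain ⟨χ, hsupp, hsum, hχ, -⟩ :=
    exists_continuous_sum_one_of_isOpen_isCompact (fun i => hU (x i)) hK hcov
  set B : ℝ := ∑ k ∈ s, ∑ i, |a k (x i)| with hB
  have hB0 : 0 ≤ B := by positivity
  set δ : ℝ := ε / (4 * (B + 1)) with hδ
  have hδ0 : 0 < δ := by positivity
  have hδB : δ * 2 * B < ε / 2 := by
    rw [hδ, div_mul_eq_mul_div, div_mul_eq_mul_div, div_lt_iff₀ (by positivity)]
    nlinarith
  choose p hp using fun i => MvPolynomial.exists_abs_eval_sub_lt hK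
    ((χ i).continuous.add (continuous_const (y := δ))) hδ0
  simp only [Pi.add_apply] at hp
  refine ⟨F.card, x, p, fun i => hFK _ (F.equivFin.symm i).2, fun i y hy => ?_, fun k hk y hy => ?_⟩
  · have h1 := (abs_lt.1 (hp i y hy)).1
    have h2 := (hχ i y).1
    linarith
  have h1 : ∑ i, χ i y = 1 := by simpa using hsum hy
  have h2 : a k y - ∑ i, MvPolynomial.eval y (p i) * a k (x i)
      = ∑ i, χ i y * (a k y - a k (x i))
        + ∑ i, (χ i y - MvPolynomial.eval y (p i)) * a k (x i) := by
    rw [← Finset.sum_add_distrib]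
    calc _ = (∑ i, χ i y) * a k y - ∑ i, MvPolynomial.eval y (p i) * a k (x i) := by
          rw [h1, one_mul]
      _ = _ := by
          rw [Finset.sum_mul, ← Finset.sum_sub_distrib]
          exact Finset.sum_congr rfl fun i _ => by ring
  have h3 : |∑ i, χ i y * (a k y - a k (x i))| ≤ ε / 2 := by
    calc _ ≤ ∑ i, |χ i y * (a k y - a k (x i))| := Finset.abs_sum_le_sum_abs _ _
      _ ≤ ∑ i, χ i y * (ε / 2) := by
          refine Finset.sum_le_sum fun i _ => ?_
          rw [abs_mul, abs_of_nonneg (hχ i y).1]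
          by_cases h0 : χ i y = 0
          · simp [h0]
          · have hy' : y ∈ U (x i) := hsupp i (subset_tsupport _ h0)
            exact mul_le_mul_of_nonneg_left (hy' k hk).le (hχ i y).1
      _ = ε / 2 := by rw [← Finset.sum_mul, h1, one_mul]
  have h4 : |∑ i, (χ i y - MvPolynomial.eval y (p i)) * a k (x i)| ≤ δ * 2 * B := by
    calc _ ≤ ∑ i, |(χ i y - MvPolynomial.eval y (p i)) * a k (x i)| :=
          Finset.abs_sum_le_sum_abs _ _
      _ ≤ ∑ i, δ * 2 * |a k (x i)| := by
          refine Finset.sum_le_sum fun i _ => ?_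
          rw [abs_mul]
          refine mul_le_mul_of_nonneg_right ?_ (abs_nonneg _)
          have := abs_lt.1 (hp i y hy)
          rw [abs_le]
          constructor <;> linarith
      _ = δ * 2 * ∑ i, |a k (x i)| := by rw [Finset.mul_sum]
      _ ≤ δ * 2 * B := by
          refine mul_le_mul_of_nonneg_left ?_ (by positivity)
          exact Finset.single_le_sum (f := fun k => ∑ i, |a k (x i)|)
            (fun _ _ => by positivity) hk
  rw [h2]
  linarith [abs_add_le (∑ i, χ i y * (a k y - a k (x i)))
    (∑ i, (χ i y - MvPolynomial.eval y (p i)) * a k (x i))]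

end Approximation

section Functional

variable {n : ℕ} {T : Subsemiring (MvPolynomial (Fin n) ℝ)}
  {L : Polynomial (MvPolynomial (Fin n) ℝ) →ₗ[ℝ] ℝ} {K : Set (Fin n → ℝ)}

theorem abs_map_sq_mul_C_le (hL : ∀ p ∈ T, ∀ h, 0 ≤ L (h ^ 2 * C p))
    {e : MvPolynomial (Fin n) ℝ} {ε : ℝ} (h1 : MvPolynomial.C ε - e ∈ T)
    (h2 : MvPolynomial.C ε + e ∈ T) (h : Polynomial (MvPolynomial (Fin n) ℝ)) :
    |L (h ^ 2 * C e)| ≤ ε * L (h ^ 2) := by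
  have key : L (h ^ 2 * C (MvPolynomial.C ε)) = ε * L (h ^ 2) := by
    have : h ^ 2 * C (MvPolynomial.C ε) = ε • h ^ 2 := by
      rw [Algebra.smul_def, mul_comm]
      rfl
    rw [this, map_smul, smul_eq_mul]
  have h3 := hL _ h1 h
  have h4 := hL _ h2 h
  rw [C_sub, mul_sub, map_sub, key] at h3
  rw [C_add, mul_add, map_add, key] at h4
  rw [abs_le]
  constructor <;> linarith

/-- Every polynomial is a difference of two squares. -/
theorem exists_sq_sub_sq (p : Polynomial (MvPolynomial (Fin n) ℝ)) :
    ∃ u v, p = u ^ 2 - v ^ 2 := by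
  have half2 : (C (MvPolynomial.C (1 / 2 : ℝ)) * 2 : Polynomial (MvPolynomial (Fin n) ℝ)) = 1 := by
    rw [← map_ofNat C 2, ← map_mul, ← map_ofNat MvPolynomial.C 2, ← map_mul]
    norm_num
  set c : Polynomial (MvPolynomial (Fin n) ℝ) := C (MvPolynomial.C (1 / 2 : ℝ))
  refine ⟨c * (p + 1), c * (p - 1), ?_⟩
  linear_combination (-p * c * 2 - p) * half2

/-- A linear functional on `ℝ[x][t]` that is nonnegative on `σ² p` for `p` in a preordering
containing all polynomials positive on a compact set `K` is nonnegative on all polynomials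
nonnegative on `K × ℝ`. -/
theorem map_nonneg_of_nonneg_on_cylinder (hL : ∀ p ∈ T, ∀ h, 0 ≤ L (h ^ 2 * C p))
    (hK : IsCompact K) (hT : ∀ p, (∀ x ∈ K, 0 < MvPolynomial.eval x p) → p ∈ T)
    (f : Polynomial (MvPolynomial (Fin n) ℝ))
    (hf : ∀ x ∈ K, ∀ t : ℝ, 0 ≤ eval₂ (MvPolynomial.eval x) t f) : 0 ≤ L f := by
  choose u v huv using fun k : ℕ => exists_sq_sub_sq (n := n) (X ^ k)
  set S : ℝ := ∑ k ∈ f.support, (L (u k ^ 2) + L (v k ^ 2)) with hS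
  suffices h : ∀ ε : ℝ, 0 < ε → -(ε * S) ≤ L f by
    have hlim : Filter.Tendsto (fun ε : ℝ => -(ε * S)) (nhdsWithin 0 (Set.Ioi 0))
        (nhds (-(0 * S))) :=
      ((by fun_prop : Continuous fun ε : ℝ => -(ε * S)).tendsto 0).mono_left nhdsWithin_le_nhds
    rw [zero_mul, neg_zero] at hlim
    refine le_of_tendsto hlim ?_
    filter_upwards [self_mem_nhdsWithin] with ε hε using h ε hε
  intro ε hε
  obtain ⟨N, x, p, hx, hp, happ⟩ := exists_pos_polynomial_interpolation hK (s := f.support)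
    (a := fun k y => MvPolynomial.eval y (f.coeff k))
    (fun k => MvPolynomial.continuous_eval (f.coeff k)) hε
  set e : ℕ → MvPolynomial (Fin n) ℝ := fun k =>
    f.coeff k - ∑ i, p i * MvPolynomial.C (MvPolynomial.eval (x i) (f.coeff k)) with he
  set q : Fin N → Polynomial (MvPolynomial (Fin n) ℝ) := fun i =>
    (f.map (MvPolynomial.eval (x i))).map MvPolynomial.C with hq
  have hdecomp : f = ∑ i, C (p i) * q i + ∑ k ∈ f.support, X ^ k * C (e k) := by
    ext1 d
    simp only [coeff_add, finsetSum_coeff, coeff_C_mul, coeff_mul_C, coeff_X_pow, hq, coeff_map,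
      ite_mul, one_mul, zero_mul, Finset.sum_ite_eq]
    by_cases hd : d ∈ f.support
    · simp [hd, he]
    · simp [notMem_support_iff.1 hd]
  have hq0 : 0 ≤ L (∑ i, C (p i) * q i) := by
    rw [map_sum]
    refine Finset.sum_nonneg fun i _ => ?_
    obtain ⟨a, b, hab⟩ := exists_sq_add_sq_of_nonneg (f.map (MvPolynomial.eval (x i)))
      fun t => by rw [eval_map]; exact hf _ (hx i) t
    have hpi := hT _ (hp i)
    have : C (p i) * q i
        = a.map MvPolynomial.C ^ 2 * C (p i) + b.map MvPolynomial.C ^ 2 * C (p i) := by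
      simp only [hq]
      rw [hab, Polynomial.map_add, Polynomial.map_pow, Polynomial.map_pow]
      ring
    rw [this, map_add]
    exact add_nonneg (hL _ hpi _) (hL _ hpi _)
  have herr : |L (∑ k ∈ f.support, X ^ k * C (e k))| ≤ ε * S := by
    rw [map_sum, hS, Finset.mul_sum]
    refine (Finset.abs_sum_le_sum_abs _ _).trans (Finset.sum_le_sum fun k hk => ?_)
    have hev : ∀ y ∈ K, |MvPolynomial.eval y (e k)| < ε := fun y hy => by
      simpa [he] using happ k hk y hy
    have h1 : MvPolynomial.C ε - e k ∈ T := hT _ fun y hy => by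
      have := (abs_lt.1 (hev y hy)).2
      simpa using this
    have h2 : MvPolynomial.C ε + e k ∈ T := hT _ fun y hy => by
      have := (abs_lt.1 (hev y hy)).1
      rw [map_add, MvPolynomial.eval_C]
      linarith
    have h3 := abs_map_sq_mul_C_le hL h1 h2 (u k)
    have h4 := abs_map_sq_mul_C_le hL h1 h2 (v k)
    rw [huv k, sub_mul, map_sub, mul_add]
    exact (abs_sub _ _).trans (add_le_add h3 h4)
  have hsum := congrArg L hdecomp
  rw [map_add] at hsum
  rw [hsum]
  linarith [(abs_le.1 herr).1]

end Functional

section Preordering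

variable {R ι : Type*} [CommRing R] [Fintype ι]

/-- The preordering generated by a finite family `g`. -/
def preordering (g : ι → R) : Subsemiring R :=
  Submonoid.subsemiringClosure
    { carrier := {a | ∃ (h : R) (β : ι → Bool), a = h ^ 2 * ∏ j, if β j then g j else 1}
      one_mem' := ⟨1, fun _ => false, by simp⟩
      mul_mem' := by
        rintro _ _ ⟨h, β, rfl⟩ ⟨h', β', rfl⟩
        refine ⟨h * h' * ∏ j, (if β j && β' j then g j else 1), fun j => xor (β j) (β' j), ?_⟩
        have : (∏ j, if β j then g j else 1) * (∏ j, if β' j then g j else 1)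
            = (∏ j, if β j && β' j then g j else 1) ^ 2 *
              ∏ j, if xor (β j) (β' j) then g j else 1 := by
          rw [← Finset.prod_pow, ← Finset.prod_mul_distrib, ← Finset.prod_mul_distrib]
          refine Finset.prod_congr rfl fun j _ => ?_
          cases β j <;> cases β' j <;> simp [sq]
        linear_combination (h ^ 2 * h' ^ 2) * this }

theorem mem_preordering_iff {g : ι → R} {a : R} :
    a ∈ preordering g ↔ a ∈ AddSubmonoid.closure
      {a | ∃ (h : R) (β : ι → Bool), a = h ^ 2 * ∏ j, if β j then g j else 1} := by
  rw [preordering, ← SetLike.mem_coe, Submonoid.subsemiringClosure_coe]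
  rfl

theorem sq_mem_preordering (g : ι → R) (a : R) : a ^ 2 ∈ preordering g :=
  mem_preordering_iff.2 (AddSubmonoid.subset_closure ⟨a, fun _ => false, by simp⟩)

open Classical in
theorem mem_preordering (g : ι → R) (j : ι) : g j ∈ preordering g :=
  mem_preordering_iff.2 (AddSubmonoid.subset_closure ⟨1, fun i => decide (i = j), by simp⟩)

end Preordering

/-- The Riesz functional as a linear map. -/
theorem exists_linearMap_eq_riesz {n : ℕ} (z : (Fin n →₀ ℕ) × ℕ → ℝ) :
    ∃ L : Polynomial (MvPolynomial (Fin n) ℝ) →ₗ[ℝ] ℝ, ∀ f, L f = riesz z f := by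
  refine ⟨Polynomial.lsum fun k =>
    (MvPolynomial.basisMonomials (Fin n) ℝ).constr ℝ fun α => z (α, k), fun f => ?_⟩
  rw [Polynomial.lsum_apply, riesz]
  congr 1
  ext k c
  rw [Module.Basis.constr_apply]
  rfl

/-- Let `K = {x : gⱼ(x) ≥ 0}` be compact.  If a real sequence
`z = (z_{αk})` satisfies `L_z(h² ⬝ g^β) ≥ 0` for all `β ∈ {0,1}^m` and all
`h ∈ ℝ[x,t]`, then `L_z(f) ≥ 0` for every polynomial `f` nonnegative on `K × ℝ`. -/
theorem riesz_nonneg_on_nonneg_polynomials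
    {n m : ℕ} (g : Fin m → MvPolynomial (Fin n) ℝ)
    (K : Set (Fin n → ℝ))
    (hKdef : K = {x : Fin n → ℝ | ∀ j, 0 ≤ MvPolynomial.eval x (g j)})
    (hK : IsCompact K)
    (z : (Fin n →₀ ℕ) × ℕ → ℝ)
    (hz : ∀ (β : Fin m → Bool) (h : Polynomial (MvPolynomial (Fin n) ℝ)),
      0 ≤ riesz z (h ^ 2 * Polynomial.C (∏ j, if β j then g j else 1))) :
    ∀ f : Polynomial (MvPolynomial (Fin n) ℝ),
      (∀ x ∈ K, ∀ t : ℝ, 0 ≤ Polynomial.eval₂ (MvPolynomial.eval x) t f) →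
      0 ≤ riesz z f := by
  intro f hf
  obtain ⟨L, hLz⟩ := exists_linearMap_eq_riesz z
  rw [← hLz]
  refine map_nonneg_of_nonneg_on_cylinder (T := preordering g) (fun p hp h => ?_) hK
    (fun p hp => ?_) f hf
  · rw [mem_preordering_iff] at hp
    induction hp using AddSubmonoid.closure_induction with
    | mem p hp =>
      obtain ⟨a, β, rfl⟩ := hp
      have := hz β (h * C a)
      rwa [← hLz, mul_pow, ← C_pow, mul_assoc, ← C_mul] at this
    | zero => simp
    | add p q _ _ hp hq =>
      rw [C_add, mul_add, map_add]
      exact add_nonneg hp hq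
  · subst hKdef
    exact mem_of_pos_on_compact (sq_mem_preordering g) g (mem_preordering g) hK p hp
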